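/- arXiv:1410.3608 — 3 statements merged into one kernel-verified Lean document; each statement's English description precedes it below -/
import Mathlib

section
/- Let (X,ρ,μ) be a space of homogeneous type with quasi-triangle constant κ, and let q > 1. Then for all σ, σ' > κ, the classes RH_q^σ and RH_q^{σ'} contain exactly the same weights: RH_q^σ = RH_q^{σ'}. -/
open MeasureTheory ENNReal

namespace SHT

variable {X : Type*}

/-- The quasi-metric ball `B(x,r) = {y : ρ(x,y) < r}`. -/
def qball (ρ : X → X → ℝ) (x : X) (r : ℝ) : Set X := {y | ρ x y < r}

/-- `(X, ρ, μ)` is a space of homogeneous type with quasi-triangle constant `κ`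
and doubling constant `D`. -/
structure IsSHT [MeasurableSpace X] (ρ : X → X → ℝ) (μ : Measure X) (κ D : ℝ) : Prop where
  nonneg : ∀ x y, 0 ≤ ρ x y
  eq_zero_iff : ∀ x y, ρ x y = 0 ↔ x = y
  symm : ∀ x y, ρ x y = ρ y x
  one_le_kappa : 1 ≤ κ
  quasi_triangle : ∀ x y z, ρ x y ≤ κ * (ρ x z + ρ z y)
  ball_measurable : ∀ (x : X) (r : ℝ), MeasurableSet (qball ρ x r)
  ball_pos : ∀ (x : X) (r : ℝ), 0 < r → 0 < μ (qball ρ x r)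
  ball_lt_top : ∀ (x : X) (r : ℝ), μ (qball ρ x r) < ⊤
  doubling : ∀ (x : X) (r : ℝ), μ (qball ρ x (2 * r)) ≤ ENNReal.ofReal D * μ (qball ρ x r)

/-- A weight: a nonnegative (here `ℝ≥0∞`-valued) measurable, locally integrable function. -/
def IsWeight [MeasurableSpace X] (ρ : X → X → ℝ) (μ : Measure X) (w : X → ℝ≥0∞) : Prop :=
  Measurable w ∧ ∀ (x : X) (r : ℝ), ∫⁻ y in qball ρ x r, w y ∂μ < ⊤

/-- The non-centered Hardy-Littlewood maximal operator. -/
noncomputable def maximal [MeasurableSpace X] (ρ : X → X → ℝ) (μ : Measure X)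
    (f : X → ℝ≥0∞) (x : X) : ℝ≥0∞ :=
  ⨆ (z : X) (r : ℝ) (_ : 0 < r) (_ : x ∈ qball ρ z r),
    (μ (qball ρ z r))⁻¹ * ∫⁻ y in qball ρ z r, f y ∂μ

/-- The centered Hardy-Littlewood maximal operator. -/
noncomputable def cmaximal [MeasurableSpace X] (ρ : X → X → ℝ) (μ : Measure X)
    (f : X → ℝ≥0∞) (x : X) : ℝ≥0∞ :=
  ⨆ (r : ℝ) (_ : 0 < r), (μ (qball ρ x r))⁻¹ * ∫⁻ y in qball ρ x r, f y ∂μ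

/-- The average `⨍_E f dμ`. -/
noncomputable def avg [MeasurableSpace X] (μ : Measure X) (E : Set X) (f : X → ℝ≥0∞) : ℝ≥0∞ :=
  (μ E)⁻¹ * ∫⁻ y in E, f y ∂μ

/-- The `σ`-weak Fujii-Wilson `A_∞` inequality with constant `C`:
`∫_B M(1_B w) dμ ≤ C ⋅ w(σB)` for all balls `B`. -/
def AinftyIneq [MeasurableSpace X] (ρ : X → X → ℝ) (μ : Measure X) (σ : ℝ)
    (w : X → ℝ≥0∞) (C : ℝ≥0∞) : Prop :=
  ∀ (x : X) (r : ℝ), 0 < r →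
    ∫⁻ y in qball ρ x r, maximal ρ μ ((qball ρ x r).indicator w) y ∂μ
      ≤ C * ∫⁻ y in qball ρ x (σ * r), w y ∂μ

/-- Membership in the `σ`-weak `A_∞` class. -/
def MemAinfty [MeasurableSpace X] (ρ : X → X → ℝ) (μ : Measure X) (σ : ℝ)
    (w : X → ℝ≥0∞) : Prop :=
  ∃ C : ℝ≥0∞, C ≠ ⊤ ∧ AinftyIneq ρ μ σ w C

/-- The constant `[w]_∞^σ`: the least admissible constant. -/
noncomputable def ainftyConst [MeasurableSpace X] (ρ : X → X → ℝ) (μ : Measure X) (σ : ℝ)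
    (w : X → ℝ≥0∞) : ℝ≥0∞ :=
  sInf {C : ℝ≥0∞ | AinftyIneq ρ μ σ w C}

/-- Membership in the weak `A_∞` class: `w ∈ A_∞^σ` for some `σ > κ`. -/
def MemAinftyWeak [MeasurableSpace X] (ρ : X → X → ℝ) (μ : Measure X) (κ : ℝ)
    (w : X → ℝ≥0∞) : Prop :=
  ∃ σ : ℝ, κ < σ ∧ MemAinfty ρ μ σ w

/-- The `σ`-weak `q`-Reverse Hölder inequality with constant `C`:
`(⨍_B w^q dμ)^{1/q} ≤ C ⋅ ⨍_{σB} w dμ` for all balls `B`. -/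
def RHIneq [MeasurableSpace X] (ρ : X → X → ℝ) (μ : Measure X) (q σ : ℝ)
    (w : X → ℝ≥0∞) (C : ℝ≥0∞) : Prop :=
  ∀ (x : X) (r : ℝ), 0 < r →
    (avg μ (qball ρ x r) (fun y => w y ^ q)) ^ (1 / q)
      ≤ C * avg μ (qball ρ x (σ * r)) w

/-- Membership in the `σ`-weak `q`-Reverse Hölder class `RH_q^σ`. -/
def MemRH [MeasurableSpace X] (ρ : X → X → ℝ) (μ : Measure X) (q σ : ℝ)
    (w : X → ℝ≥0∞) : Prop :=
  ∃ C : ℝ≥0∞, C ≠ ⊤ ∧ RHIneq ρ μ q σ w C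

/-- The constant `[w]_{RH_q}^σ`: the least admissible constant. -/
noncomputable def rhConst [MeasurableSpace X] (ρ : X → X → ℝ) (μ : Measure X) (q σ : ℝ)
    (w : X → ℝ≥0∞) : ℝ≥0∞ :=
  sInf {C : ℝ≥0∞ | RHIneq ρ μ q σ w C}

/-- Membership in the weak `q`-Reverse Hölder class: `w ∈ RH_q^σ` for some `σ > κ`. -/
def MemRHWeak [MeasurableSpace X] (ρ : X → X → ℝ) (μ : Measure X) (κ q : ℝ)
    (w : X → ℝ≥0∞) : Prop :=
  ∃ σ : ℝ, κ < σ ∧ MemRH ρ μ q σ w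

/-- Finite subadditivity of the lower integral in the domain of integration. -/
theorem lintegral_biUnion_finset_le [MeasurableSpace X] {ι : Type*} (μ : Measure X)
    (S : Finset ι) (s : ι → Set X) (f : X → ℝ≥0∞) :
    ∫⁻ z in ⋃ i ∈ S, s i, f z ∂μ ≤ ∑ i ∈ S, ∫⁻ z in s i, f z ∂μ := by
  classical
  induction S using Finset.induction_on with
  | empty => simp
  | insert a S ha ih =>
    rw [Finset.set_biUnion_insert, Finset.sum_insert ha]
    exact (lintegral_union_le f _ _).trans (add_le_add_right ih _)

/-- A ball centred at a point of `B(x,r)` is contained in a dilate of `B(x,r)`. -/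
theorem IsSHT.qball_subset [MeasurableSpace X] {ρ : X → X → ℝ} {μ : Measure X} {κ D : ℝ}
    (hX : IsSHT ρ μ κ D) {x y : X} {r s t : ℝ} (hxy : ρ x y < r) (ht : κ * (r + s) ≤ t) :
    qball ρ y s ⊆ qball ρ x t := by
  intro z hz
  have hz' : ρ y z < s := hz
  have hκ := hX.one_le_kappa
  calc ρ x z ≤ κ * (ρ x y + ρ y z) := hX.quasi_triangle x z y
    _ < κ * (r + s) := by gcongr
    _ ≤ t := ht

/-- Iterated doubling: dilating a ball by a fixed factor increases its measure by at most
a fixed finite factor. -/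
theorem IsSHT.exists_measure_dilate_le [MeasurableSpace X] {ρ : X → X → ℝ} {μ : Measure X}
    {κ D : ℝ} (hX : IsSHT ρ μ κ D) (l : ℝ) :
    ∃ A : ℝ≥0∞, A ≠ ⊤ ∧ ∀ (x : X) (r : ℝ), 0 < r →
      μ (qball ρ x (l * r)) ≤ A * μ (qball ρ x r) := by
  obtain ⟨n, hn⟩ := pow_unbounded_of_one_lt l (one_lt_two : (1 : ℝ) < 2)
  have pow_doubling : ∀ (n : ℕ) (x : X) (r : ℝ),
      μ (qball ρ x (2 ^ n * r)) ≤ ENNReal.ofReal D ^ n * μ (qball ρ x r) := by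
    intro n x r
    induction n with
    | zero => simp
    | succ k ih =>
      calc μ (qball ρ x (2 ^ (k + 1) * r)) = μ (qball ρ x (2 * (2 ^ k * r))) := by ring_nf
        _ ≤ ENNReal.ofReal D * μ (qball ρ x (2 ^ k * r)) := hX.doubling _ _
        _ ≤ ENNReal.ofReal D * (ENNReal.ofReal D ^ k * μ (qball ρ x r)) := by gcongr
        _ = ENNReal.ofReal D ^ (k + 1) * μ (qball ρ x r) := by ring
  refine ⟨ENNReal.ofReal D ^ n, by simp, fun x r hr => le_trans ?_ (pow_doubling n x r)⟩
  exact measure_mono fun z (hz : ρ x z < l * r) =>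
    hz.trans_le (mul_le_mul_of_nonneg_right hn.le hr.le)

/-- Balls of comparable radii with nearby centres have comparable measures. -/
theorem IsSHT.exists_measure_le_of_mem [MeasurableSpace X] {ρ : X → X → ℝ} {μ : Measure X}
    {κ D : ℝ} (hX : IsSHT ρ μ κ D) (K : ℝ) {δ : ℝ} (hδ : 0 < δ) :
    ∃ A : ℝ≥0∞, A ≠ ⊤ ∧ ∀ (x y : X) (r : ℝ), 0 < r → ρ x y < r →
      μ (qball ρ x (K * r)) ≤ A * μ (qball ρ y (δ * r)) := by
  obtain ⟨A, hA, h⟩ := hX.exists_measure_dilate_le (κ * (1 + K) / δ)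
  refine ⟨A, hA, fun x y r hr hxy => le_trans (measure_mono ?_) (h y (δ * r) (by positivity))⟩
  refine hX.qball_subset (hX.symm x y ▸ hxy) (le_of_eq ?_)
  field_simp

/-- Balls of radius `r` are covered by a uniformly bounded number of balls of radius `ε r`. -/
theorem IsSHT.exists_finset_cover [MeasurableSpace X] {ρ : X → X → ℝ} {μ : Measure X}
    {κ D : ℝ} (hX : IsSHT ρ μ κ D) {ε : ℝ} (hε : 0 < ε) :
    ∃ N : ℝ≥0∞, N ≠ ⊤ ∧ ∀ (x : X) (r : ℝ), 0 < r → ∃ S : Finset X, (S.card : ℝ≥0∞) ≤ N ∧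
      (∀ y ∈ S, ρ x y < r) ∧ qball ρ x r ⊆ ⋃ y ∈ S, qball ρ y (ε * r) := by
  classical
  have hκ : 0 < κ := one_pos.trans_le hX.one_le_kappa
  set δ : ℝ := ε / (2 * κ) with hδ_def
  have hδ : 0 < δ := by positivity
  set K : ℝ := κ * (1 + δ) with hK_def
  have hK : 0 < K := by positivity
  obtain ⟨N, hN, hcomp⟩ := hX.exists_measure_le_of_mem K hδ
  refine ⟨N, hN, fun x r hr => ?_⟩
  have card_le : ∀ S : Finset X, (∀ y ∈ S, ρ x y < r) →
      (∀ y ∈ S, ∀ z ∈ S, y ≠ z → ε * r ≤ ρ y z) → (S.card : ℝ≥0∞) ≤ N := by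
    intro S hS hsep
    have hdisj : Set.PairwiseDisjoint (S : Set X) fun y => qball ρ y (δ * r) := by
      intro y hy z hz hyz
      refine Set.disjoint_left.2 fun u hu hv => ?_
      have hu' : ρ y u < δ * r := hu
      have hv' : ρ u z < δ * r := hX.symm u z ▸ hv
      have : ρ y z < ε * r := calc
        ρ y z ≤ κ * (ρ y u + ρ u z) := hX.quasi_triangle y z u
        _ < κ * (δ * r + δ * r) := by gcongr
        _ = ε * r := by rw [hδ_def]; field_simp; ring
      exact absurd (hsep y hy z hz hyz) this.not_ge
    have hmul : (S.card : ℝ≥0∞) * μ (qball ρ x (K * r)) ≤ N * μ (qball ρ x (K * r)) := calc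
      (S.card : ℝ≥0∞) * μ (qball ρ x (K * r)) = ∑ _y ∈ S, μ (qball ρ x (K * r)) := by
        rw [Finset.sum_const, nsmul_eq_mul]
      _ ≤ ∑ y ∈ S, N * μ (qball ρ y (δ * r)) :=
        Finset.sum_le_sum fun y hy => hcomp x y r hr (hS y hy)
      _ = N * μ (⋃ y ∈ S, qball ρ y (δ * r)) := by
        rw [measure_biUnion_finset hdisj fun y _ => hX.ball_measurable y _, Finset.mul_sum]
      _ ≤ N * μ (qball ρ x (K * r)) := by
        gcongr
        exact Set.iUnion₂_subset fun y hy =>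
          hX.qball_subset (hS y hy) (le_of_eq (by rw [hK_def]; ring))
    exact (ENNReal.mul_le_mul_iff_left (hX.ball_pos x _ (by positivity)).ne'
      (hX.ball_lt_top x _).ne).1 hmul
  by_contra! hcon
  have exists_separated : ∀ n : ℕ, ∃ S : Finset X, S.card = n ∧ (∀ y ∈ S, ρ x y < r) ∧
      ∀ y ∈ S, ∀ z ∈ S, y ≠ z → ε * r ≤ ρ y z := by
    intro n
    induction n with
    | zero => exact ⟨∅, by simp⟩
    | succ n ih =>
      obtain ⟨S, hcard, hS, hsep⟩ := ih
      obtain ⟨u, hu, hu'⟩ := Set.not_subset.1 (hcon S (card_le S hS hsep) hS)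
      have hfar : ∀ y ∈ S, ε * r ≤ ρ y u := fun y hy =>
        not_lt.1 fun h => hu' (Set.mem_biUnion hy h)
      have huS : u ∉ S := fun h => by
        have := hfar u h
        rw [(hX.eq_zero_iff u u).2 rfl] at this
        exact (mul_pos hε hr).not_ge this
      refine ⟨insert u S, by rw [Finset.card_insert_of_notMem huS, hcard], ?_, ?_⟩
      · intro y hy
        rcases Finset.mem_insert.1 hy with rfl | hy
        exacts [hu, hS y hy]
      · intro y hy z hz hyz
        rcases Finset.mem_insert.1 hy with rfl | hy' <;>
          rcases Finset.mem_insert.1 hz with rfl | hz'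
        exacts [absurd rfl hyz, hX.symm z y ▸ hfar z hz', hfar y hy', hsep y hy' z hz' hyz]
  obtain ⟨n, hn⟩ := ENNReal.exists_nat_gt hN
  obtain ⟨S, hcard, hS, hsep⟩ := exists_separated n
  exact hn.not_ge (hcard ▸ card_le S hS hsep)

/-- The `σ`-weak reverse Hölder class is contained in the `σ'`-weak one for all `σ, σ' > κ`. -/
theorem MemRH.of_kappa_lt [MeasurableSpace X] {ρ : X → X → ℝ} {μ : Measure X} {κ D : ℝ}
    (hX : IsSHT ρ μ κ D) {q : ℝ} (hq : 0 < q) {σ σ' : ℝ} (hσ : κ < σ) (hσ' : κ < σ')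
    {w : X → ℝ≥0∞} (hw : MemRH ρ μ q σ w) : MemRH ρ μ q σ' w := by
  have hκ : 0 < κ := one_pos.trans_le hX.one_le_kappa
  have hσ0 : 0 < σ := hκ.trans hσ
  obtain ⟨C, hC, hRH⟩ := hw
  set ε : ℝ := (σ' - κ) / (κ * σ) with hε_def
  have hε : 0 < ε := div_pos (sub_pos.2 hσ') (by positivity)
  obtain ⟨N, hN, hcover⟩ := hX.exists_finset_cover hε
  obtain ⟨A, hA, hcomp⟩ := hX.exists_measure_le_of_mem σ' (mul_pos hσ0 hε)
  obtain ⟨A', hA', hdil⟩ := hX.exists_measure_dilate_le (κ * (1 + ε))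
  refine ⟨(N * A') ^ (1 / q) * (C * A), ENNReal.mul_ne_top (ENNReal.rpow_ne_top_of_nonneg
    (by positivity) (ENNReal.mul_ne_top hN hA')) (ENNReal.mul_ne_top hC hA), fun x r hr => ?_⟩
  obtain ⟨S, hcard, hS, hsub⟩ := hcover x r hr
  set T : ℝ≥0∞ := C * A * avg μ (qball ρ x (σ' * r)) w with hT
  have hball0 : μ (qball ρ x r) ≠ 0 := (hX.ball_pos x r hr).ne'
  have hball : μ (qball ρ x r) ≠ ⊤ := (hX.ball_lt_top x r).ne
  have avg_le : ∀ y ∈ S, avg μ (qball ρ y (σ * (ε * r))) w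
      ≤ A * avg μ (qball ρ x (σ' * r)) w := by
    intro y hy
    have hpos := hX.ball_pos y (σ * (ε * r)) (by positivity)
    have htop := hX.ball_lt_top y (σ * (ε * r))
    have hpos' := hX.ball_pos x (σ' * r) (mul_pos (hκ.trans hσ') hr)
    have htop' := hX.ball_lt_top x (σ' * r)
    have hinv : (μ (qball ρ y (σ * (ε * r))))⁻¹ ≤ A * (μ (qball ρ x (σ' * r)))⁻¹ := by
      rw [← div_eq_mul_inv, ENNReal.le_div_iff_mul_le (.inl hpos'.ne') (.inl htop'.ne),
        mul_comm, ← div_eq_mul_inv, ENNReal.div_le_iff hpos.ne' htop.ne, ← mul_assoc]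
      exact hcomp x y r hr (hS y hy)
    have hincl : qball ρ y (σ * (ε * r)) ⊆ qball ρ x (σ' * r) :=
      hX.qball_subset (hS y hy) (le_of_eq (by rw [hε_def]; field_simp; ring))
    unfold avg
    rw [← mul_assoc A]
    exact mul_le_mul' hinv (lintegral_mono_set hincl)
  have lintegral_le : ∀ y ∈ S, ∫⁻ z in qball ρ y (ε * r), w z ^ q ∂μ
      ≤ T ^ q * (A' * μ (qball ρ x r)) := by
    intro y hy
    have hpos := hX.ball_pos y (ε * r) (by positivity)
    have htop := hX.ball_lt_top y (ε * r)
    have hle : avg μ (qball ρ y (ε * r)) (fun z => w z ^ q) ≤ T ^ q := by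
      rw [← ENNReal.rpow_inv_le_iff hq, ← one_div, hT, mul_assoc]
      exact (hRH y (ε * r) (by positivity)).trans (mul_le_mul_right (avg_le y hy) C)
    have hincl : qball ρ y (ε * r) ⊆ qball ρ x (κ * (1 + ε) * r) :=
      hX.qball_subset (hS y hy) (le_of_eq (by ring))
    unfold avg at hle
    rw [mul_comm, ← div_eq_mul_inv, ENNReal.div_le_iff hpos.ne' htop.ne] at hle
    exact hle.trans (mul_le_mul_right ((measure_mono hincl).trans (hdil x r hr)) _)
  have key : avg μ (qball ρ x r) (fun y => w y ^ q) ≤ N * A' * T ^ q := by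
    unfold avg
    rw [mul_comm, ← div_eq_mul_inv, ENNReal.div_le_iff hball0 hball]
    calc ∫⁻ z in qball ρ x r, w z ^ q ∂μ
        ≤ ∫⁻ z in ⋃ y ∈ S, qball ρ y (ε * r), w z ^ q ∂μ := lintegral_mono_set hsub
      _ ≤ ∑ y ∈ S, ∫⁻ z in qball ρ y (ε * r), w z ^ q ∂μ := lintegral_biUnion_finset_le μ S _ _
      _ ≤ ∑ _y ∈ S, T ^ q * (A' * μ (qball ρ x r)) := Finset.sum_le_sum lintegral_le
      _ = S.card * (T ^ q * (A' * μ (qball ρ x r))) := by rw [Finset.sum_const, nsmul_eq_mul]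
      _ ≤ N * (T ^ q * (A' * μ (qball ρ x r))) := by gcongr
      _ = N * A' * T ^ q * μ (qball ρ x r) := by ring
  calc (avg μ (qball ρ x r) (fun y => w y ^ q)) ^ (1 / q)
      ≤ (N * A' * T ^ q) ^ (1 / q) := by gcongr
    _ = (N * A') ^ (1 / q) * T := by
      rw [ENNReal.mul_rpow_of_nonneg _ _ (by positivity), one_div, ENNReal.rpow_rpow_inv hq.ne']
    _ = (N * A') ^ (1 / q) * (C * A) * avg μ (qball ρ x (σ' * r)) w := by rw [hT, ← mul_assoc]

/-- The classes `RH_q^σ` coincide for all `σ > κ`. -/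
theorem memRH_congr [MeasurableSpace X] (ρ : X → X → ℝ) (μ : Measure X)
    (κ D : ℝ) (hX : IsSHT ρ μ κ D) (q : ℝ) (hq : 1 < q) :
    ∀ σ σ' : ℝ, κ < σ → κ < σ' → ∀ w : X → ℝ≥0∞, IsWeight ρ μ w →
      (MemRH ρ μ q σ w ↔ MemRH ρ μ q σ' w) := by
  intro σ σ' hσ hσ' w _
  have hq0 : 0 < q := one_pos.trans hq
  exact ⟨MemRH.of_kappa_lt hX hq0 hσ hσ', MemRH.of_kappa_lt hX hq0 hσ' hσ⟩

end SHT
end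

section
/- Let (X,ρ,μ) be a space of homogeneous type with quasi-triangle constant κ, let q > 1, and let w be a weight with w ∈ RH_q^weak. Then w^q ∈ A_∞^weak. -/
open MeasureTheory ENNReal

namespace SHT

variable {X : Type*}

section Interpolation

/-- A geometric sum over the dyadic levels below `b`. -/
lemma tsum_dyadic_lt_le {p : ℝ} (hp : 0 < p) (b : ℝ≥0∞) :
    ∑' k : ℤ, (if (2 : ℝ≥0∞) ^ k < b then ((2 : ℝ≥0∞) ^ k) ^ p else 0)
      ≤ (1 - ((2 : ℝ≥0∞) ^ p)⁻¹)⁻¹ * b ^ p := by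
  rcases eq_or_ne b 0 with rfl | hb
  · simp
  rcases eq_or_ne b ⊤ with rfl | hb'
  · rw [ENNReal.top_rpow_of_pos hp, ENNReal.mul_top]
    · exact le_top
    · rw [ENNReal.inv_ne_zero]
      exact ne_top_of_le_ne_top one_ne_top tsub_le_self
  obtain ⟨m, hm, hm'⟩ := ENNReal.exists_mem_Ioc_zpow hb hb' ENNReal.one_lt_two ofNat_ne_top
  set g : ℤ → ℝ≥0∞ := fun k => if (2 : ℝ≥0∞) ^ k < b then ((2 : ℝ≥0∞) ^ k) ^ p else 0 with hg
  have hsupp : Function.support (fun k : ℤ => g (m - k)) ⊆ Set.range ((↑) : ℕ → ℤ) := by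
    intro k hk
    by_contra hkn
    have hk0 : k < 0 := by
      by_contra! h
      exact hkn ⟨k.toNat, by simp [h]⟩
    apply hk
    have : ¬ (2 : ℝ≥0∞) ^ (m - k) < b :=
      not_lt.2 (hm'.trans (ENNReal.zpow_le_of_le ENNReal.one_lt_two.le (by lia)))
    simp [hg, this]
  calc ∑' k, g k = ∑' k, g (m - k) := ((Equiv.subLeft m).tsum_eq g).symm
    _ = ∑' j : ℕ, g (m - j) := (Function.Injective.tsum_eq Nat.cast_injective hsupp).symm
    _ ≤ ∑' j : ℕ, ((2 : ℝ≥0∞) ^ m) ^ p * (((2 : ℝ≥0∞) ^ p)⁻¹) ^ j := by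
        refine ENNReal.tsum_le_tsum fun j => ?_
        have : ((2 : ℝ≥0∞) ^ (m - (j : ℤ))) ^ p
            = ((2 : ℝ≥0∞) ^ m) ^ p * (((2 : ℝ≥0∞) ^ p)⁻¹) ^ j := by
          rw [ENNReal.zpow_sub two_ne_zero ofNat_ne_top, ENNReal.mul_rpow_of_nonneg _ _ hp.le,
            ENNReal.inv_rpow, zpow_natCast, ← ENNReal.inv_pow, ← ENNReal.rpow_natCast,
            ← ENNReal.rpow_natCast, ← ENNReal.rpow_mul, ← ENNReal.rpow_mul, mul_comm p]
        simp only [hg]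
        split_ifs
        · exact this.le
        · exact zero_le
    _ = (1 - ((2 : ℝ≥0∞) ^ p)⁻¹)⁻¹ * ((2 : ℝ≥0∞) ^ m) ^ p := by
        rw [ENNReal.tsum_mul_left, ENNReal.tsum_geometric, mul_comm]
    _ ≤ _ := by gcongr

lemma rpow_le_tsum_dyadic {q : ℝ} (hq : 0 < q) (a : ℝ≥0∞) :
    a ^ q ≤ ∑' k : ℤ, (if (2 : ℝ≥0∞) ^ k < a then ((2 : ℝ≥0∞) ^ (k + 1)) ^ q else 0) := by
  rcases eq_or_ne a 0 with rfl | ha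
  · simp [hq]
  rcases eq_or_ne a ⊤ with rfl | ha'
  · refine le_trans ?_ (ENNReal.tsum_comp_le_tsum_of_injective
      (Nat.cast_injective : Function.Injective ((↑) : ℕ → ℤ)) _)
    refine le_trans ?_ (ENNReal.tsum_le_tsum (f := fun _ : ℕ => 1) fun j => ?_)
    · rw [ENNReal.tsum_const_eq_top_of_ne_zero one_ne_zero]
      exact le_top
    · rw [if_pos (ENNReal.zpow_lt_top two_ne_zero ofNat_ne_top _)]
      refine ENNReal.one_le_rpow ?_ hq
      simpa using ENNReal.zpow_le_of_le ENNReal.one_lt_two.le (show (0 : ℤ) ≤ j + 1 by lia)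
  obtain ⟨m, hm, hm'⟩ := ENNReal.exists_mem_Ioc_zpow ha ha' ENNReal.one_lt_two ofNat_ne_top
  refine le_trans ?_ (ENNReal.le_tsum m)
  rw [if_pos hm]
  gcongr

/-- Marcinkiewicz interpolation at the dyadic levels; `F` need not be measurable. -/
lemma lintegral_rpow_le_of_weak_type [MeasurableSpace X] {μ : Measure X} {f F : X → ℝ≥0∞}
    (hf : Measurable f) {A : ℝ≥0∞} {q : ℝ} (hq : 1 < q)
    (hweak : ∀ k : ℤ, μ {x | (2 : ℝ≥0∞) ^ k < F x}
      ≤ A * ((2 : ℝ≥0∞) ^ k)⁻¹ * ∫⁻ x in {x | (2 : ℝ≥0∞) ^ k < 2 * f x}, f x ∂μ) :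
    ∫⁻ x, F x ^ q ∂μ
      ≤ A * 2 ^ q * ((1 - ((2 : ℝ≥0∞) ^ (q - 1))⁻¹)⁻¹ * 2 ^ (q - 1)) * ∫⁻ x, f x ^ q ∂μ := by
  have hp : 0 < q - 1 := sub_pos.2 hq
  have hlev (k : ℤ) : MeasurableSet {x | (2 : ℝ≥0∞) ^ k < 2 * f x} :=
    measurableSet_lt measurable_const (hf.const_mul 2)
  have hcoef (k : ℤ) : ((2 : ℝ≥0∞) ^ (k + 1)) ^ q * ((2 : ℝ≥0∞) ^ k)⁻¹
      = 2 ^ q * ((2 : ℝ≥0∞) ^ k) ^ (q - 1) := by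
    rw [ENNReal.zpow_add two_ne_zero ofNat_ne_top, zpow_one,
      ENNReal.mul_rpow_of_nonneg _ _ (by linarith), mul_comm (((2 : ℝ≥0∞) ^ k) ^ q), mul_assoc,
      ENNReal.rpow_sub _ _ (ENNReal.zpow_pos two_ne_zero ofNat_ne_top _).ne'
        (ENNReal.zpow_ne_top two_ne_zero ofNat_ne_top _), ENNReal.rpow_one, div_eq_mul_inv]
  calc ∫⁻ x, F x ^ q ∂μ
      ≤ ∫⁻ x, ∑' k : ℤ, (toMeasurable μ {x | (2 : ℝ≥0∞) ^ k < F x}).indicator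
          (fun _ => ((2 : ℝ≥0∞) ^ (k + 1)) ^ q) x ∂μ := by
        refine lintegral_mono fun x => (rpow_le_tsum_dyadic (by linarith) (F x)).trans ?_
        refine ENNReal.tsum_le_tsum fun k => ?_
        split_ifs with h
        · rw [Set.indicator_of_mem (subset_toMeasurable μ _ h)]
        · exact zero_le
    _ = ∑' k : ℤ, ((2 : ℝ≥0∞) ^ (k + 1)) ^ q * μ {x | (2 : ℝ≥0∞) ^ k < F x} := by
        rw [lintegral_tsum fun k =>
          (measurable_const.indicator (measurableSet_toMeasurable _ _)).aemeasurable]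
        congr! 2 with k
        rw [lintegral_indicator_const (measurableSet_toMeasurable _ _), measure_toMeasurable]
    _ ≤ ∑' k : ℤ, A * 2 ^ q * ∫⁻ x, {x | (2 : ℝ≥0∞) ^ k < 2 * f x}.indicator
          (fun x => ((2 : ℝ≥0∞) ^ k) ^ (q - 1) * f x) x ∂μ := by
        refine ENNReal.tsum_le_tsum fun k => ?_
        rw [lintegral_indicator (hlev k), lintegral_const_mul _ hf]
        calc _ ≤ ((2 : ℝ≥0∞) ^ (k + 1)) ^ q * (A * ((2 : ℝ≥0∞) ^ k)⁻¹ *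
                ∫⁻ x in {x | (2 : ℝ≥0∞) ^ k < 2 * f x}, f x ∂μ) := by gcongr; exact hweak k
          _ = A * (((2 : ℝ≥0∞) ^ (k + 1)) ^ q * ((2 : ℝ≥0∞) ^ k)⁻¹) *
                ∫⁻ x in {x | (2 : ℝ≥0∞) ^ k < 2 * f x}, f x ∂μ := by ring
          _ = _ := by rw [hcoef]; ring
    _ = A * 2 ^ q * ∫⁻ x, ∑' k : ℤ, {x | (2 : ℝ≥0∞) ^ k < 2 * f x}.indicator
          (fun x => ((2 : ℝ≥0∞) ^ k) ^ (q - 1) * f x) x ∂μ := by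
        rw [ENNReal.tsum_mul_left, lintegral_tsum fun k =>
          ((hf.const_mul _).indicator (hlev k)).aemeasurable]
    _ ≤ A * 2 ^ q * ∫⁻ x, ((1 - ((2 : ℝ≥0∞) ^ (q - 1))⁻¹)⁻¹ * 2 ^ (q - 1)) * f x ^ q ∂μ := by
        gcongr with x
        calc _ = ∑' k : ℤ, (if (2 : ℝ≥0∞) ^ k < 2 * f x then ((2 : ℝ≥0∞) ^ k) ^ (q - 1) else 0)
                * f x := by
              refine tsum_congr fun k => ?_
              simp [Set.indicator_apply, ite_mul]
          _ ≤ (1 - ((2 : ℝ≥0∞) ^ (q - 1))⁻¹)⁻¹ * (2 * f x) ^ (q - 1) * f x := by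
              rw [ENNReal.tsum_mul_right]
              gcongr
              exact tsum_dyadic_lt_le hp _
          _ = _ := by
              have : f x ^ q = f x ^ (q - 1) * f x := by
                conv_rhs => rw [← ENNReal.rpow_one (f x), ← ENNReal.rpow_mul, one_mul]
                rw [← ENNReal.rpow_add_of_nonneg _ _ hp.le zero_le_one, sub_add_cancel]
              rw [this, ENNReal.mul_rpow_of_nonneg _ _ hp.le]
              ring
    _ = _ := by rw [lintegral_const_mul _ (hf.pow_const q), ← mul_assoc]

end Interpolation

namespace IsSHT

variable [MeasurableSpace X] {ρ : X → X → ℝ} {μ : Measure X} {κ D : ℝ}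

lemma kappa_pos (hX : IsSHT ρ μ κ D) : 0 < κ := one_pos.trans_le hX.one_le_kappa

lemma mem_qball_self (hX : IsSHT ρ μ κ D) (x : X) {r : ℝ} (hr : 0 < r) : x ∈ qball ρ x r := by
  simpa [qball, (hX.eq_zero_iff x x).2 rfl] using hr

/-- The doubling property for an arbitrary dilation factor. -/
lemma exists_measure_qball_mul_le (hX : IsSHT ρ μ κ D) (c : ℝ) :
    ∃ K : ℝ≥0∞, K ≠ ⊤ ∧ ∀ x r, 0 < r → μ (qball ρ x (c * r)) ≤ K * μ (qball ρ x r) := by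
  obtain ⟨n, hn⟩ := pow_unbounded_of_one_lt c one_lt_two
  have hpow (m : ℕ) (x : X) (r : ℝ) :
      μ (qball ρ x (2 ^ m * r)) ≤ ENNReal.ofReal D ^ m * μ (qball ρ x r) := by
    induction m with
    | zero => simp
    | succ m ih =>
      rw [pow_succ', pow_succ', mul_assoc, mul_assoc]
      exact (hX.doubling _ _).trans (by gcongr)
  refine ⟨ENNReal.ofReal D ^ n, ENNReal.pow_ne_top ofReal_ne_top, fun x r hr => ?_⟩
  refine (measure_mono fun y (hy : ρ x y < c * r) => ?_).trans (hpow n x r)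
  exact hy.trans_le (by gcongr)

lemma sigmaFinite (hX : IsSHT ρ μ κ D) : SigmaFinite μ := by
  rcases isEmpty_or_nonempty X with h | ⟨⟨x⟩⟩
  · rw [Measure.eq_zero_of_isEmpty μ]
    infer_instance
  · refine ⟨⟨⟨fun n => qball ρ x n, fun _ => trivial, fun n => hX.ball_lt_top x n, ?_⟩⟩⟩
    refine Set.eq_univ_of_forall fun y => Set.mem_iUnion.2 ?_
    exact exists_nat_gt (ρ x y)

end IsSHT

/-- The non-centered maximal operator over balls of radius at most `R`. -/
noncomputable def truncMaximal [MeasurableSpace X] (ρ : X → X → ℝ) (μ : Measure X) (R : ℝ)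
    (f : X → ℝ≥0∞) (x : X) : ℝ≥0∞ :=
  ⨆ (z : X) (r : ℝ) (_ : 0 < r) (_ : r ≤ R) (_ : x ∈ qball ρ z r), avg μ (qball ρ z r) f

namespace IsSHT

variable [MeasurableSpace X] {ρ : X → X → ℝ} {μ : Measure X} {κ D : ℝ}

/-- Each ball of a family with bounded radii lies in a fixed dilation of a member of a countable
disjoint subfamily. -/
lemma exists_countable_disjoint_subfamily (hX : IsSHT ρ μ κ D) {R : ℝ} (T : Set (X × ℝ))
    (hT : ∀ a ∈ T, 0 < a.2 ∧ a.2 ≤ R) :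
    ∃ u ⊆ T, u.Countable ∧ u.PairwiseDisjoint (fun a => qball ρ a.1 a.2) ∧
      ∀ a ∈ T, ∃ b ∈ u, qball ρ a.1 a.2 ⊆ qball ρ b.1 (κ * (1 + 4 * κ) * b.2) := by
  have := hX.sigmaFinite
  obtain ⟨u, huT, hdisj, hcov⟩ := Vitali.exists_disjoint_subfamily_covering_enlargement
    (fun a : X × ℝ => qball ρ a.1 a.2) T (fun a => a.2) 2 one_lt_two (fun a ha => (hT a ha).1.le)
    R (fun a ha => (hT a ha).2) (fun a ha => ⟨a.1, hX.mem_qball_self _ (hT a ha).1⟩)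
  refine ⟨u, huT, ?_, hdisj, fun a ha => ?_⟩
  · have hc := Measure.countable_meas_pos_of_disjoint_iUnion (μ := μ)
      (As := fun a : u => qball ρ a.1.1 a.1.2) (fun a => hX.ball_measurable _ _)
      (fun a b hab => hdisj a.2 b.2 (Subtype.coe_injective.ne hab))
    have huniv : {a : u | 0 < μ (qball ρ a.1.1 a.1.2)} = Set.univ :=
      Set.eq_univ_of_forall fun a => hX.ball_pos _ _ (hT _ (huT a.2)).1
    rw [huniv, Set.countable_univ_iff] at hc
    exact hc
  · obtain ⟨b, hb, ⟨p, hpa, hpb⟩, hab⟩ := hcov a ha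
    refine ⟨b, hb, fun y hy => ?_⟩
    simp only [qball, Set.mem_ofPred_eq] at hpa hpb hy ⊢
    have hκ := hX.kappa_pos
    have hpy : ρ p y < κ * (4 * b.2) := by
      refine (hX.quasi_triangle p y a.1).trans_lt ?_
      rw [hX.symm p a.1]
      gcongr
      linarith
    calc ρ b.1 y ≤ κ * (ρ b.1 p + ρ p y) := hX.quasi_triangle _ _ _
      _ < κ * (b.2 + κ * (4 * b.2)) := by gcongr
      _ = _ := by ring

/-- The weak-type (1,1) inequality, with the constant independent of the radius bound. -/
lemma exists_weak_type_truncMaximal (hX : IsSHT ρ μ κ D) :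
    ∃ A : ℝ≥0∞, A ≠ ⊤ ∧ ∀ (R : ℝ) (f : X → ℝ≥0∞) (t : ℝ≥0∞), t ≠ 0 → t ≠ ⊤ →
      μ {x | t < truncMaximal ρ μ R f x} ≤ A * t⁻¹ * ∫⁻ x, f x ∂μ := by
  obtain ⟨K, hK, hdouble⟩ := hX.exists_measure_qball_mul_le (κ * (1 + 4 * κ))
  refine ⟨K, hK, fun R f t ht ht' => ?_⟩
  set T : Set (X × ℝ) := {a | (0 < a.2 ∧ a.2 ≤ R) ∧ t < avg μ (qball ρ a.1 a.2) f}
  obtain ⟨u, huT, hu, hdisj, hcov⟩ := hX.exists_countable_disjoint_subfamily T (fun a ha => ha.1)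
  have hball : ∀ a ∈ T, μ (qball ρ a.1 a.2) ≤ t⁻¹ * ∫⁻ x in qball ρ a.1 a.2, f x ∂μ := by
    intro a ha
    have h := ha.2.le
    rw [avg, mul_comm, ← div_eq_mul_inv,
      ENNReal.le_div_iff_mul_le (.inl (hX.ball_pos _ _ ha.1.1).ne') (.inl (hX.ball_lt_top _ _).ne),
      mul_comm] at h
    rwa [mul_comm, ← div_eq_mul_inv, ENNReal.le_div_iff_mul_le (.inl ht) (.inl ht')]
  have hsub : {x | t < truncMaximal ρ μ R f x}
      ⊆ ⋃ a ∈ u, qball ρ a.1 (κ * (1 + 4 * κ) * a.2) := by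
    intro x hx
    simp only [truncMaximal, Set.mem_ofPred_eq, lt_iSup_iff] at hx
    obtain ⟨z, r, hr, hrR, hxz, h⟩ := hx
    obtain ⟨b, hb, hsub⟩ := hcov (z, r) ⟨⟨hr, hrR⟩, h⟩
    exact Set.mem_biUnion hb (hsub hxz)
  have : Countable u := hu.to_subtype
  calc μ {x | t < truncMaximal ρ μ R f x}
      ≤ ∑' a : u, μ (qball ρ a.1.1 (κ * (1 + 4 * κ) * a.1.2)) :=
        (measure_mono hsub).trans (measure_biUnion_le μ hu _)
    _ ≤ ∑' a : u, K * t⁻¹ * ∫⁻ x in qball ρ a.1.1 a.1.2, f x ∂μ := by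
        refine ENNReal.tsum_le_tsum fun a => (hdouble _ _ (huT a.2).1.1).trans ?_
        rw [mul_assoc]
        gcongr
        exact hball _ (huT a.2)
    _ = K * t⁻¹ * ∫⁻ x in ⋃ a ∈ u, qball ρ a.1 a.2, f x ∂μ := by
        rw [ENNReal.tsum_mul_left, lintegral_biUnion hu (fun a _ => hX.ball_measurable _ _) hdisj]
    _ ≤ _ := by gcongr; exact Measure.restrict_le_self

lemma truncMaximal_le_half_add (hX : IsSHT ρ μ κ D) {R : ℝ} {f : X → ℝ≥0∞}
    (t : ℝ≥0∞) (x : X) :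
    truncMaximal ρ μ R f x ≤ t / 2 + truncMaximal ρ μ R ({y | t < 2 * f y}.indicator f) x := by
  simp only [truncMaximal, iSup_le_iff]
  intro z r hr hrR hx
  have hle : avg μ (qball ρ z r) f
      ≤ t / 2 + avg μ (qball ρ z r) ({y | t < 2 * f y}.indicator f) := by
    calc avg μ (qball ρ z r) f
        ≤ avg μ (qball ρ z r) (fun y => t / 2 + {y | t < 2 * f y}.indicator f y) := by
          unfold avg
          gcongr with y
          beta_reduce
          by_cases h : t < 2 * f y
          · rw [Set.indicator_of_mem (show y ∈ {y | t < 2 * f y} from h)]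
            exact le_add_self
          · refine le_add_right ?_
            rw [ENNReal.le_div_iff_mul_le (.inl two_ne_zero) (.inl ofNat_ne_top), mul_comm]
            exact not_lt.1 h
      _ = _ := by
          unfold avg
          rw [lintegral_add_left measurable_const, mul_add, setLIntegral_const, mul_comm (t / 2),
            ← mul_assoc, ENNReal.inv_mul_cancel (hX.ball_pos _ _ hr).ne' (hX.ball_lt_top _ _).ne,
            one_mul]
  refine hle.trans ?_
  gcongr
  exact le_iSup_of_le z <| le_iSup_of_le r <| le_iSup_of_le hr <| le_iSup_of_le hrR <|
    le_iSup_of_le hx le_rfl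

/-- The strong-type (q,q) inequality, with the constant independent of the radius bound. -/
lemma exists_strong_type_truncMaximal (hX : IsSHT ρ μ κ D) {q : ℝ} (hq : 1 < q) :
    ∃ A : ℝ≥0∞, A ≠ ⊤ ∧ ∀ (R : ℝ) (f : X → ℝ≥0∞), Measurable f →
      ∫⁻ x, truncMaximal ρ μ R f x ^ q ∂μ ≤ A * ∫⁻ x, f x ^ q ∂μ := by
  obtain ⟨A, hA, hweak⟩ := hX.exists_weak_type_truncMaximal
  have hp : 0 < q - 1 := sub_pos.2 hq
  refine ⟨A * 2 * 2 ^ q * ((1 - ((2 : ℝ≥0∞) ^ (q - 1))⁻¹)⁻¹ * 2 ^ (q - 1)), ?_, fun R f hf =>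
    lintegral_rpow_le_of_weak_type hf hq fun k => ?_⟩
  · refine ENNReal.mul_ne_top (ENNReal.mul_ne_top (ENNReal.mul_ne_top hA ofNat_ne_top)
      (ENNReal.rpow_ne_top_of_nonneg (by linarith) ofNat_ne_top))
      (ENNReal.mul_ne_top ?_ (ENNReal.rpow_ne_top_of_nonneg hp.le ofNat_ne_top))
    rw [ENNReal.inv_ne_top, ← pos_iff_ne_zero, tsub_pos_iff_lt, ENNReal.inv_lt_one]
    exact ENNReal.one_lt_rpow ENNReal.one_lt_two hp
  · set t : ℝ≥0∞ := 2 ^ k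
    have ht : t ≠ 0 := (ENNReal.zpow_pos two_ne_zero ofNat_ne_top _).ne'
    have ht' : t ≠ ⊤ := ENNReal.zpow_ne_top two_ne_zero ofNat_ne_top _
    have hsub : {x | t < truncMaximal ρ μ R f x}
        ⊆ {x | t / 2 < truncMaximal ρ μ R ({y | t < 2 * f y}.indicator f) x} := by
      intro x (hx : t < _)
      by_contra h
      have h' : truncMaximal ρ μ R ({y | t < 2 * f y}.indicator f) x ≤ t / 2 := not_lt.1 h
      refine hx.not_ge ((hX.truncMaximal_le_half_add t x).trans ?_)
      calc _ ≤ t / 2 + t / 2 := by gcongr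
        _ = t := ENNReal.add_halves t
    refine (measure_mono hsub).trans ((hweak R _ (t / 2) (by simp [ht])
      (ENNReal.div_ne_top ht' two_ne_zero)).trans_eq ?_)
    rw [lintegral_indicator (measurableSet_lt measurable_const (hf.const_mul 2)),
      ENNReal.inv_div (.inl ofNat_ne_top) (.inl two_ne_zero), div_eq_mul_inv, mul_assoc A 2]

/-- Averages over balls that are not small compared with `B(x₀,R)` are controlled by the average
over `B(x₀,R)`. -/
lemma avg_indicator_le_of_large (hX : IsSHT ρ μ κ D) {K : ℝ≥0∞}
    (hK : ∀ x r, 0 < r → μ (qball ρ x (κ * (1 + 2 * κ) * r)) ≤ K * μ (qball ρ x r))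
    {x₀ x z : X} {R r : ℝ} (hR : 0 < R) (hRr : R ≤ r) (hx : x ∈ qball ρ x₀ R)
    (hxz : x ∈ qball ρ z r) (v : X → ℝ≥0∞) :
    avg μ (qball ρ z r) ((qball ρ x₀ R).indicator v) ≤ K * avg μ (qball ρ x₀ R) v := by
  have hκ := hX.kappa_pos
  have hsub : qball ρ x₀ R ⊆ qball ρ z (κ * (1 + 2 * κ) * r) := by
    intro y hy
    simp only [qball, Set.mem_ofPred_eq] at hx hxz hy ⊢
    have hxy : ρ x y < κ * (2 * r) := by
      refine (hX.quasi_triangle x y x₀).trans_lt ?_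
      rw [hX.symm x x₀]
      gcongr
      linarith
    calc ρ z y ≤ κ * (ρ z x + ρ x y) := hX.quasi_triangle _ _ _
      _ < κ * (r + κ * (2 * r)) := by gcongr
      _ = _ := by ring
  have hμ : μ (qball ρ x₀ R) ≤ K * μ (qball ρ z r) :=
    (measure_mono hsub).trans (hK z r (hR.trans_le hRr))
  have hinv : (μ (qball ρ z r))⁻¹ ≤ K * (μ (qball ρ x₀ R))⁻¹ := by
    rw [← div_eq_mul_inv,
      ENNReal.le_div_iff_mul_le (.inl (hX.ball_pos _ _ hR).ne') (.inl (hX.ball_lt_top _ _).ne),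
      mul_comm, ← div_eq_mul_inv]
    exact ENNReal.div_le_of_le_mul hμ
  unfold avg
  rw [← mul_assoc, ← lintegral_indicator (hX.ball_measurable x₀ R)]
  exact mul_le_mul' hinv (setLIntegral_le_lintegral _ _)

/-- On `B(x₀,R)`, averages of `w ^ q` over balls of radius at most `R` are controlled by the
truncated maximal function of the restriction of `w` to a dilated ball. -/
lemma avg_indicator_le_of_small (hX : IsSHT ρ μ κ D) {q σ : ℝ} (hq : 0 < q) (hσ : 1 ≤ σ)
    {w : X → ℝ≥0∞} {C : ℝ≥0∞} (hC : RHIneq ρ μ q σ w C)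
    {x₀ x z : X} {R r c : ℝ} (hc : κ * (1 + κ * (1 + σ)) ≤ c) (hr : 0 < r) (hrR : r ≤ R)
    (hx : x ∈ qball ρ x₀ R) (hxz : x ∈ qball ρ z r) :
    avg μ (qball ρ z r) ((qball ρ x₀ R).indicator fun y => w y ^ q)
      ≤ C ^ q * truncMaximal ρ μ (σ * R) ((qball ρ x₀ (c * R)).indicator w) x ^ q := by
  have hκ := hX.kappa_pos
  have hR : 0 < R := hr.trans_le hrR
  have hrσ : r ≤ σ * r := le_mul_of_one_le_left hr.le hσ
  have hsub : qball ρ z (σ * r) ⊆ qball ρ x₀ (c * R) := by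
    intro y hy
    simp only [qball, Set.mem_ofPred_eq] at hx hxz hy ⊢
    calc ρ x₀ y ≤ κ * (ρ x₀ x + ρ x y) := hX.quasi_triangle _ _ _
      _ ≤ κ * (ρ x₀ x + κ * (ρ x z + ρ z y)) := by gcongr; exact hX.quasi_triangle _ _ _
      _ < κ * (R + κ * (r + σ * r)) := by rw [hX.symm x z]; gcongr
      _ ≤ κ * (R + κ * (R + σ * R)) := by gcongr
      _ = κ * (1 + κ * (1 + σ)) * R := by ring
      _ ≤ c * R := by gcongr
  have havg : avg μ (qball ρ z (σ * r)) w
      ≤ truncMaximal ρ μ (σ * R) ((qball ρ x₀ (c * R)).indicator w) x := by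
    have heq : avg μ (qball ρ z (σ * r)) w
        = avg μ (qball ρ z (σ * r)) ((qball ρ x₀ (c * R)).indicator w) := by
      unfold avg
      congr 1
      exact setLIntegral_congr_fun (hX.ball_measurable _ _)
        fun y hy => (Set.indicator_of_mem (hsub hy) w).symm
    have hxσ : x ∈ qball ρ z (σ * r) := lt_of_lt_of_le hxz hrσ
    rw [heq]
    exact le_iSup_of_le z <| le_iSup_of_le (σ * r) <| le_iSup_of_le (hr.trans_le hrσ) <|
      le_iSup_of_le (by gcongr) <| le_iSup_of_le hxσ le_rfl
  calc avg μ (qball ρ z r) ((qball ρ x₀ R).indicator fun y => w y ^ q)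
      ≤ avg μ (qball ρ z r) (fun y => w y ^ q) := by
        unfold avg
        gcongr with y
        exact Set.indicator_le_self _ _ y
    _ ≤ (C * avg μ (qball ρ z (σ * r)) w) ^ q := by
        have h := hC z r hr
        rwa [one_div, ENNReal.rpow_inv_le_iff hq] at h
    _ ≤ (C * truncMaximal ρ μ (σ * R) ((qball ρ x₀ (c * R)).indicator w) x) ^ q := by gcongr
    _ = _ := ENNReal.mul_rpow_of_nonneg _ _ hq.le

end IsSHT

/-- If `w ∈ RH_q^weak`, then `w^q ∈ A_∞^weak`. -/
theorem memAinftyWeak_pow_of_memRHWeak [MeasurableSpace X] (ρ : X → X → ℝ)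
    (μ : Measure X) (κ D : ℝ) (hX : IsSHT ρ μ κ D) (q : ℝ) (hq : 1 < q)
    (w : X → ℝ≥0∞) (hw : IsWeight ρ μ w) (hmem : MemRHWeak ρ μ κ q w) :
    MemAinftyWeak ρ μ κ (fun x => w x ^ q) := by
  obtain ⟨σ, hσκ, C, hC, hRH⟩ := hmem
  have hκ := hX.one_le_kappa
  have hκ0 := hX.kappa_pos
  have hσ : 1 ≤ σ := hκ.trans hσκ.le
  have hq0 : 0 < q := one_pos.trans hq
  obtain ⟨K, hK, hdouble⟩ := hX.exists_measure_qball_mul_le (κ * (1 + 2 * κ))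
  obtain ⟨A, hA, hstrong⟩ := hX.exists_strong_type_truncMaximal hq
  set c : ℝ := κ * (1 + κ * (1 + σ)) with hc
  have hκc : κ < c := by
    have : 0 < κ * (κ * (1 + σ)) := by positivity
    linarith [mul_add κ 1 (κ * (1 + σ))]
  refine ⟨c, hκc, K + C ^ q * A, ENNReal.add_ne_top.2
    ⟨hK, ENNReal.mul_ne_top (ENNReal.rpow_ne_top_of_nonneg hq0.le hC) hA⟩, fun x₀ R hR => ?_⟩
  set B := qball ρ x₀ R with hB
  set f : X → ℝ≥0∞ := (qball ρ x₀ (c * R)).indicator w with hf_def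
  have hf : Measurable f := hw.1.indicator (hX.ball_measurable _ _)
  have hpoint : ∀ x ∈ B, maximal ρ μ (B.indicator fun y => w y ^ q) x
      ≤ K * avg μ B (fun y => w y ^ q) + C ^ q * truncMaximal ρ μ (σ * R) f x ^ q := by
    intro x hx
    simp only [maximal, iSup_le_iff]
    intro z r hr hxz
    rcases le_total r R with hrR | hRr
    · exact le_add_left (hX.avg_indicator_le_of_small hq0 hσ hRH hc.ge hr hrR hx hxz)
    · exact le_add_right (hX.avg_indicator_le_of_large hdouble hR hRr hx hxz _)
  have hfq : ∫⁻ x, f x ^ q ∂μ = ∫⁻ x in qball ρ x₀ (c * R), w x ^ q ∂μ := by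
    rw [← lintegral_indicator (hX.ball_measurable _ _)]
    congr! 2 with x
    by_cases hx : x ∈ qball ρ x₀ (c * R) <;> simp [hf_def, hx, hq0]
  have hBsub : B ⊆ qball ρ x₀ (c * R) := fun y (hy : ρ x₀ y < R) =>
    hy.trans_le (le_mul_of_one_le_left hR.le (hκ.trans hκc.le))
  calc ∫⁻ y in B, maximal ρ μ (B.indicator fun x => w x ^ q) y ∂μ
      ≤ ∫⁻ y in B, (K * avg μ B (fun y => w y ^ q)
          + C ^ q * truncMaximal ρ μ (σ * R) f y ^ q) ∂μ :=
        setLIntegral_mono' (hX.ball_measurable _ _) hpoint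
    _ = K * ∫⁻ y in B, w y ^ q ∂μ + C ^ q * ∫⁻ y in B, truncMaximal ρ μ (σ * R) f y ^ q ∂μ := by
        rw [lintegral_add_left measurable_const, setLIntegral_const,
          lintegral_const_mul' _ _ (ENNReal.rpow_ne_top_of_nonneg hq0.le hC), mul_assoc, avg,
          mul_comm (_ * _) (μ B), ENNReal.mul_inv_cancel_left (hX.ball_pos _ _ hR).ne'
            (hX.ball_lt_top _ _).ne]
    _ ≤ K * ∫⁻ y in qball ρ x₀ (c * R), w y ^ q ∂μ
          + C ^ q * (A * ∫⁻ y in qball ρ x₀ (c * R), w y ^ q ∂μ) := by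
        gcongr
        rw [← hfq]
        exact (setLIntegral_le_lintegral _ _).trans (hstrong _ _ hf)
    _ = _ := by ring

end SHT
end

section
/- (Failure of the strong Reverse Hölder Inequality for A_∞ weights in spaces of homogeneous type.) In the metric measure space (X,d,μ) described below, with h(t) := t^{-1}·(log(e/t))^{-3} and the weight f built from h and any sequence (ε_j) with ε_j ∈ (0,1] and ε_j → 0, the following hold: (a) f ∈ A_∞, i.e. there is a finite constant C such that ∫_B M(1_B f) dμ ≤ C·∫_B f dμ for every ball B of X; (b) for every p > 1, f ∉ RH_p, i.e. there is no finite constant C with (⨍_B f^p dμ)^{1/p} ≤ C·⨍_B f dμ for all balls B of X. -/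
open MeasureTheory ENNReal

namespace Counterexample

/-- The infinite line `A = ℝ × {0}`. -/
def lineA : Set (ℝ × ℝ) := {p | p.2 = 0}

/-- The slanted segment `U = {(u, u/2) : u ∈ (0,1]}`. -/
def segU : Set (ℝ × ℝ) := {p | ∃ u : ℝ, 0 < u ∧ u ≤ 1 ∧ p = (u, u / 2)}

/-- The vertical segment `V = {1} × [1/2, 1]`. -/
def segV : Set (ℝ × ℝ) := {p | p.1 = 1 ∧ 1 / 2 ≤ p.2 ∧ p.2 ≤ 1}

/-- `W = U ∪ V`. -/
def segW : Set (ℝ × ℝ) := segU ∪ segV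

/-- `W_j = W + (10j, 0)`. -/
def segWj (j : ℕ) : Set (ℝ × ℝ) := (fun p => p + ((10 * j : ℝ), 0)) '' segW

/-- The space `X = A ∪ ⋃_j W_j`.  (Recall that the product metric on `ℝ × ℝ` in Mathlib is
exactly the sup-metric `d((u₁,v₁),(u₂,v₂)) = max(|u₁-u₂|, |v₁-v₂|)`.) -/
def spaceX : Set (ℝ × ℝ) := lineA ∪ ⋃ j : ℕ, segWj j

/-- The one-dimensional Hausdorff measure on `X`, realized as the restriction to `X` of the
one-dimensional Hausdorff measure of `(ℝ², ℓ^∞)`. -/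
noncomputable def muX : Measure (ℝ × ℝ) := (μH[1]).restrict spaceX

/-- The ball of `X` centered at `z ∈ X` of radius `r`, as a subset of `ℝ × ℝ`. -/
def ballX (z : ℝ × ℝ) (r : ℝ) : Set (ℝ × ℝ) := Metric.ball z r ∩ spaceX

/-- The non-centered Hardy-Littlewood maximal operator on `X`: the supremum of averages
over balls of `X` containing the point. -/
noncomputable def mOpX (f : ℝ × ℝ → ℝ≥0∞) (x : ℝ × ℝ) : ℝ≥0∞ :=
  ⨆ (z : ℝ × ℝ) (_ : z ∈ spaceX) (r : ℝ) (_ : 0 < r) (_ : x ∈ Metric.ball z r),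
    (muX (Metric.ball z r))⁻¹ * ∫⁻ y in Metric.ball z r, f y ∂muX

/-- `g(t) = max {h(t), 1}`. -/
noncomputable def gfun (h : ℝ → ℝ) (t : ℝ) : ℝ := max (h t) 1

/-- The weight `f = f_h` built from `h` and the sequence `(ε_j)`: it equals `1` on `A`,
`ε_j` on `V_j`, and `min {1, ε_j g(u)}` at the point `(10j + u, u/2) ∈ U_j`. -/
noncomputable def fwt (h : ℝ → ℝ) (eps : ℕ → ℝ) (p : ℝ × ℝ) : ℝ≥0∞ :=
  if p.2 = 0 then 1
  else if p.2 = (p.1 - 10 * (⌊p.1 / 10⌋ : ℝ)) / 2 then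
    ENNReal.ofReal (min 1 (eps ⌊p.1 / 10⌋.toNat * gfun h (p.1 - 10 * (⌊p.1 / 10⌋ : ℝ))))
  else ENNReal.ofReal (eps ⌊p.1 / 10⌋.toNat)

/-- The function `h(t) = t⁻¹ (log(e/t))⁻³`. -/
noncomputable def h18 (t : ℝ) : ℝ := (t * Real.log (Real.exp 1 / t) ^ 3)⁻¹

/-- The factor `log (e / t)` of `h18`. -/
noncomputable def logE (t : ℝ) : ℝ := Real.log (Real.exp 1 / t)

lemma h18_eq (t : ℝ) : h18 t = (t * logE t ^ 3)⁻¹ := rfl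

lemma logE_eq {t : ℝ} (ht : 0 < t) : logE t = 1 - Real.log t := by
  rw [logE, Real.log_div (Real.exp_pos 1).ne' ht.ne', Real.log_exp]

lemma one_le_logE {t : ℝ} (ht : 0 < t) (ht1 : t ≤ 1) : 1 ≤ logE t := by
  rw [logE_eq ht]
  linarith [Real.log_nonpos ht.le ht1]

lemma logE_one : logE 1 = 1 := by simp [logE]

lemma h18_pos {t : ℝ} (ht : 0 < t) (ht1 : t ≤ 1) : 0 < h18 t := by
  have := one_le_logE ht ht1
  rw [h18_eq]
  positivity

lemma h18_one : h18 1 = 1 := by simp [h18_eq, logE_one]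

lemma gfun_h18_one : gfun h18 1 = 1 := by simp [gfun, h18_one]

lemma one_le_gfun (h : ℝ → ℝ) (t : ℝ) : 1 ≤ gfun h t := le_max_right _ _

lemma gfun_le_one_add {t : ℝ} (ht : 0 < t) (ht1 : t ≤ 1) : gfun h18 t ≤ 1 + h18 t := by
  have := h18_pos ht ht1
  exact max_le (by linarith) (by linarith)

/-- `h18` is essentially constant at comparable arguments. -/
lemma h18_le_of_comparable {t y : ℝ} (ht : 0 < t) (hy : 0 < y) (hy1 : y ≤ 1)
    (hty : t ≤ 4 * y) (hyt : y ≤ 4 * t) (ht1 : t ≤ 1) : h18 y ≤ 108 * h18 t := by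
  have hLy := one_le_logE hy hy1
  have hLt := one_le_logE ht ht1
  have hlog : logE t ≤ 3 * logE y := by
    have h1 : Real.log y ≤ Real.log (4 * t) := Real.log_le_log hy hyt
    rw [Real.log_mul (by norm_num) ht.ne'] at h1
    have h4 : Real.log 4 ≤ 2 := by
      have : (4 : ℝ) = 2 ^ 2 := by norm_num
      rw [this, Real.log_pow]
      have := Real.log_two_lt_d9
      push_cast
      linarith
    have h2 := logE_eq ht
    have h3 := logE_eq hy
    linarith
  have key : t * logE t ^ 3 ≤ 108 * (y * logE y ^ 3) := by
    have : logE t ^ 3 ≤ (3 * logE y) ^ 3 := pow_le_pow_left₀ (by linarith) hlog 3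
    calc t * logE t ^ 3 ≤ (4 * y) * (3 * logE y) ^ 3 := by gcongr
      _ = 108 * (y * logE y ^ 3) := by ring
  rw [h18_eq, h18_eq, ← div_eq_mul_inv, inv_eq_one_div, div_le_div_iff₀ (by positivity) (by positivity)]
  linarith

lemma gfun_le_of_comparable {t y : ℝ} (ht : 0 < t) (hy : 0 < y) (hy1 : y ≤ 1)
    (hty : t ≤ 4 * y) (hyt : y ≤ 4 * t) (ht1 : t ≤ 1) :
    gfun h18 y ≤ 108 * gfun h18 t := by
  have h1 := h18_le_of_comparable ht hy hy1 hty hyt ht1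
  have h2 : h18 t ≤ gfun h18 t := le_max_left _ _
  have h3 := one_le_gfun h18 t
  exact max_le (by linarith) (by linarith)

/-- The majorant `(t (log (e/t))²)⁻¹` of the maximal function of `h18`. -/
noncomputable def majorant (t : ℝ) : ℝ := (t * logE t ^ 2)⁻¹

lemma majorant_pos {t : ℝ} (ht : 0 < t) (ht1 : t ≤ 1) : 0 < majorant t := by
  have := one_le_logE ht ht1
  rw [majorant]
  positivity

lemma majorant_one : majorant 1 = 1 := by simp [majorant, logE_one]

lemma h18_le_majorant {t : ℝ} (ht : 0 < t) (ht1 : t ≤ 1) : h18 t ≤ majorant t := by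
  have h1 := one_le_logE ht ht1
  rw [h18_eq, majorant]
  have : logE t ^ 2 ≤ logE t ^ 3 := pow_le_pow_right₀ h1 (by norm_num)
  gcongr

lemma majorant_le {t a : ℝ} (ht : 0 < t) (hta : t ≤ a) (ha1 : a ≤ 1) :
    majorant a ≤ 4 * majorant t := by
  have ha : 0 < a := ht.trans_le hta
  have hLa := one_le_logE ha ha1
  have hLt := one_le_logE ht (hta.trans ha1)
  set s := Real.sqrt (a / t) with hs
  have hs2 : s ^ 2 = a / t := Real.sq_sqrt (by positivity)
  have hspos : 0 < s := Real.sqrt_pos.2 (by positivity)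
  have hs1 : 1 ≤ s := Real.one_le_sqrt.2 ((one_le_div ht).2 hta)
  have hlogs : Real.log (a / t) ≤ 2 * (s - 1) := by
    rw [← hs2, Real.log_pow]
    have := Real.log_le_sub_one_of_pos hspos
    push_cast
    linarith
  rw [Real.log_div ha.ne' ht.ne'] at hlogs
  have hlog : logE t ≤ 2 * s * logE a := by
    have h2 := logE_eq ht
    have h3 := logE_eq ha
    nlinarith
  have key : t * logE t ^ 2 ≤ 4 * (a * logE a ^ 2) := by
    calc t * logE t ^ 2 ≤ t * (2 * s * logE a) ^ 2 := by gcongr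
      _ = 4 * (t * s ^ 2 * logE a ^ 2) := by ring
      _ = 4 * (a * logE a ^ 2) := by rw [hs2, mul_div_cancel₀ _ ht.ne']
  rw [majorant, majorant, ← div_eq_mul_inv, inv_eq_one_div,
    div_le_div_iff₀ (by positivity) (by positivity)]
  linarith

lemma one_le_majorant {t : ℝ} (ht : 0 < t) (ht1 : t ≤ 1) : 1 ≤ 4 * majorant t := by
  simpa [majorant_one] using majorant_le ht ht1 le_rfl

lemma hasDerivAt_logE {t : ℝ} (ht : 0 < t) : HasDerivAt logE (-t⁻¹) t := by
  have h : HasDerivAt (fun s => 1 - Real.log s) (-t⁻¹) t := by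
    simpa using (Real.hasDerivAt_log ht.ne').const_sub 1
  refine h.congr_of_eventuallyEq ?_
  filter_upwards [lt_mem_nhds ht] with s hs using logE_eq hs

lemma continuousOn_logE_pow_inv (n : ℕ) (hn : n ≠ 0) :
    ContinuousOn (fun t => (logE t ^ n)⁻¹) (Set.Icc 0 1) := by
  intro t ht
  rcases ht.1.eq_or_lt with rfl | h0
  · have h0 : (logE 0 ^ n)⁻¹ = 0 := by simp [logE, hn]
    rw [← continuousWithinAt_sdiff_self]
    refine ContinuousWithinAt.mono (t := Set.Ioi 0) ?_ ?_
    · rw [ContinuousWithinAt, h0]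
      refine Filter.Tendsto.inv_tendsto_atTop ?_
      refine (Filter.tendsto_pow_atTop hn).comp ?_
      have : Filter.Tendsto (fun t => 1 - Real.log t) (nhdsWithin 0 (Set.Ioi 0)) Filter.atTop := by
        simpa [sub_eq_add_neg] using Filter.tendsto_atTop_add_const_left _ 1
          (Filter.tendsto_neg_atBot_atTop.comp Real.tendsto_log_nhdsGT_zero)
      refine this.congr' ?_
      filter_upwards [self_mem_nhdsWithin] with s hs using (logE_eq hs).symm
    · intro s hs
      exact lt_of_le_of_ne hs.1.1 (Ne.symm hs.2)
  · have h1 := one_le_logE h0 ht.2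
    exact ContinuousAt.continuousWithinAt
      (((hasDerivAt_logE h0).continuousAt.pow n).inv₀ (pow_ne_zero n (by linarith)))

lemma lintegral_deriv_of_nonneg {P p : ℝ → ℝ} {a : ℝ} (ha : 0 ≤ a)
    (hc : ContinuousOn P (Set.Icc 0 a)) (hd : ∀ t ∈ Set.Ioo 0 a, HasDerivAt P (p t) t)
    (hp : ∀ t ∈ Set.Ioc 0 a, 0 ≤ p t) :
    ∫⁻ t in Set.Ioc 0 a, ENNReal.ofReal (p t) = ENNReal.ofReal (P a - P 0) := by
  have hi : IntegrableOn p (Set.Ioc 0 a) :=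
    intervalIntegral.integrableOn_deriv_of_nonneg hc hd
      fun t ht => hp t (Set.Ioo_subset_Ioc_self ht)
  rw [← ofReal_integral_eq_lintegral_ofReal hi
      ((ae_restrict_iff' measurableSet_Ioc).2 (Filter.Eventually.of_forall hp)),
    ← intervalIntegral.integral_of_le ha,
    intervalIntegral.integral_eq_sub_of_hasDerivAt_of_le ha hc hd
      ((intervalIntegrable_iff_integrableOn_Ioc_of_le ha).2 hi)]

lemma lintegral_h18 {a : ℝ} (ha : 0 < a) (ha1 : a ≤ 1) :
    ∫⁻ t in Set.Ioc 0 a, ENNReal.ofReal (h18 t) = ENNReal.ofReal ((logE a ^ 2)⁻¹ / 2) := by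
  rw [lintegral_deriv_of_nonneg (P := fun t => (logE t ^ 2)⁻¹ / 2) ha.le]
  · simp [logE]
  · exact ((continuousOn_logE_pow_inv 2 two_ne_zero).mono
      (Set.Icc_subset_Icc_right ha1)).div_const 2
  · intro t ht
    have h1 := one_le_logE ht.1 (ht.2.le.trans ha1)
    have h0 : logE t ≠ 0 := by linarith
    refine ((((hasDerivAt_logE ht.1).pow 2).inv (pow_ne_zero 2 h0)).div_const 2).congr_deriv ?_
    have := ht.1
    rw [h18_eq]
    simp
    field_simp
  · exact fun t ht => (h18_pos ht.1 (ht.2.trans ha1)).le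

lemma lintegral_majorant :
    ∫⁻ t in Set.Ioc (0 : ℝ) 1, ENNReal.ofReal (majorant t) = 1 := by
  rw [lintegral_deriv_of_nonneg (P := fun t => (logE t ^ 1)⁻¹) zero_le_one]
  · simp [logE]
  · exact continuousOn_logE_pow_inv 1 one_ne_zero
  · intro t ht
    have h1 := one_le_logE ht.1 ht.2.le
    have h0 : logE t ≠ 0 := by linarith
    refine (((hasDerivAt_logE ht.1).pow 1).inv (pow_ne_zero 1 h0)).congr_deriv ?_
    have := ht.1
    rw [majorant]
    simp
    field_simp
  · exact fun t ht => (majorant_pos ht.1 ht.2).le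

/-- Local integrals of `h18` around `t` are controlled by the majorant. -/
lemma lintegral_h18_Ioo_le {t r : ℝ} (ht : 0 < t) (ht1 : t ≤ 1) (hr : 0 < r) :
    ∫⁻ u in Set.Ioc 0 1 ∩ Set.Ioo (t - 2 * r) (t + 2 * r), ENNReal.ofReal (h18 u)
      ≤ ENNReal.ofReal (432 * r * majorant t) := by
  have hm := majorant_pos ht ht1
  rcases le_or_gt (4 * r) t with h | h
  · calc _ ≤ ∫⁻ u in Set.Ioc 0 1 ∩ Set.Ioo (t - 2 * r) (t + 2 * r),
          ENNReal.ofReal (108 * majorant t) := by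
          refine setLIntegral_mono' (measurableSet_Ioc.inter measurableSet_Ioo) ?_
          rintro u ⟨⟨hu0, hu1⟩, hu2, hu3⟩
          refine ENNReal.ofReal_le_ofReal ?_
          have h1 := h18_le_of_comparable ht hu0 hu1 (by linarith) (by linarith) ht1
          have h2 := h18_le_majorant ht ht1
          linarith
      _ ≤ ENNReal.ofReal (108 * majorant t) * ENNReal.ofReal (4 * r) := by
          rw [setLIntegral_const]
          gcongr
          refine (measure_mono Set.inter_subset_right).trans ?_
          rw [Real.volume_Ioo]
          exact ENNReal.ofReal_le_ofReal (by linarith)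
      _ = _ := by
          rw [← ENNReal.ofReal_mul (by positivity)]
          congr 1
          ring
  · set a := min (6 * r) 1 with ha
    have hta : t ≤ a := le_min (by linarith) ht1
    have ha1 : a ≤ 1 := min_le_right _ _
    have ha0 : 0 < a := ht.trans_le hta
    calc _ ≤ ∫⁻ u in Set.Ioc 0 a, ENNReal.ofReal (h18 u) := by
          refine lintegral_mono_set ?_
          rintro u ⟨⟨hu0, hu1⟩, hu2, hu3⟩
          exact ⟨hu0, le_min (by linarith) hu1⟩
      _ = ENNReal.ofReal ((logE a ^ 2)⁻¹ / 2) := lintegral_h18 ha0 ha1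
      _ ≤ _ := by
          refine ENNReal.ofReal_le_ofReal ?_
          have h1 := majorant_le ht hta ha1
          have h2 : (logE a ^ 2)⁻¹ = a * majorant a := by
            have := one_le_logE ha0 ha1
            rw [majorant]
            field_simp
          rw [h2]
          have h3 : a ≤ 6 * r := min_le_left _ _
          nlinarith [mul_le_mul h3 h1 (majorant_pos ha0 ha1).le (by positivity),
            mul_pos hr hm]

/-- The isometric parametrization of (a line containing) the line `A`. -/
def embA (u : ℝ) : ℝ × ℝ := (u, 0)

/-- The isometric parametrization of the line containing `U_j`. -/
noncomputable def embU (j : ℕ) (u : ℝ) : ℝ × ℝ := (10 * j + u, u / 2)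

/-- The isometric parametrization of the line containing `V_j`. -/
def embV (j : ℕ) (v : ℝ) : ℝ × ℝ := (10 * j + 1, v)

lemma isometry_embA : Isometry embA :=
  Isometry.of_dist_eq fun u v => by simp [embA, Prod.dist_eq]

lemma isometry_embU (j : ℕ) : Isometry (embU j) :=
  Isometry.of_dist_eq fun u v => by
    have h : u / 2 - v / 2 = (u - v) / 2 := by ring
    simp only [embU, Prod.dist_eq, Real.dist_eq, h, add_sub_add_left_eq_sub, abs_div, abs_two]
    exact max_eq_left (by linarith [abs_nonneg (u - v)])

lemma isometry_embV (j : ℕ) : Isometry (embV j) :=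
  Isometry.of_dist_eq fun u v => by simp [embV, Prod.dist_eq]

lemma measurableEmbedding_of_isometry {e : ℝ → ℝ × ℝ} (he : Isometry e) :
    MeasurableEmbedding e :=
  he.isClosedEmbedding.measurableEmbedding

lemma hausdorff_image {e : ℝ → ℝ × ℝ} (he : Isometry e) (S : Set ℝ) :
    μH[1] (e '' S) = volume S := by
  rw [he.hausdorffMeasure_image (Or.inl zero_le_one), hausdorffMeasure_real]

lemma lintegral_hausdorff_image {e : ℝ → ℝ × ℝ} (he : Isometry e) (S : Set ℝ)
    (F : ℝ × ℝ → ℝ≥0∞) :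
    ∫⁻ x in e '' S, F x ∂μH[1] = ∫⁻ u in S, F (e u) := by
  have hm := measurableEmbedding_of_isometry he
  rw [← Measure.restrict_restrict_of_subset (Set.image_subset_range e S),
    ← he.map_hausdorffMeasure (Or.inl zero_le_one), hausdorffMeasure_real, hm.restrict_map,
    Set.preimage_image_eq S hm.injective, hm.lintegral_map]

lemma lineA_eq : lineA = Set.range embA := by
  ext ⟨a, b⟩
  simp [lineA, embA, eq_comm]

lemma mem_embU_image {j : ℕ} {S : Set ℝ} {p : ℝ × ℝ} :
    p ∈ embU j '' S ↔ p.1 - 10 * j ∈ S ∧ p.2 = (p.1 - 10 * j) / 2 := by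
  constructor
  · rintro ⟨u, hu, rfl⟩
    simpa [embU] using hu
  · rintro ⟨h1, h2⟩
    exact ⟨_, h1, Prod.ext (by simp [embU]) (by simp [embU, h2])⟩

lemma mem_embV_image {j : ℕ} {S : Set ℝ} {p : ℝ × ℝ} :
    p ∈ embV j '' S ↔ p.1 = 10 * j + 1 ∧ p.2 ∈ S := by
  constructor
  · rintro ⟨u, hu, rfl⟩
    simpa [embV] using hu
  · rintro ⟨h1, h2⟩
    exact ⟨_, h2, Prod.ext (by simp [embV, h1]) (by simp [embV])⟩

lemma segWj_eq (j : ℕ) :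
    segWj j = embU j '' Set.Ioc 0 1 ∪ embV j '' Set.Icc (1 / 2) 1 := by
  ext p
  rw [Set.mem_union, mem_embU_image, mem_embV_image]
  constructor
  · rintro ⟨q, ⟨u, h0, h1, rfl⟩ | ⟨h0, h1, h2⟩, rfl⟩
    · left; simp [h0, h1]
    · right
      refine ⟨?_, ?_, ?_⟩
      · simp [h0, add_comm]
      · simpa using h1
      · simpa using h2
  · rintro (⟨⟨h0, h1⟩, h2⟩ | ⟨h0, h1, h2⟩)
    · exact ⟨(p.1 - 10 * j, p.2), Or.inl ⟨_, h0, h1, by rw [h2]⟩, by ext <;> simp⟩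
    · exact ⟨(1, p.2), Or.inr ⟨rfl, h1, h2⟩, by ext <;> simp [h0, add_comm]⟩

lemma mem_segWj {j : ℕ} {p : ℝ × ℝ} :
    p ∈ segWj j ↔ ((0 < p.1 - 10 * j ∧ p.1 - 10 * j ≤ 1) ∧ p.2 = (p.1 - 10 * j) / 2) ∨
      (p.1 = 10 * j + 1 ∧ 1 / 2 ≤ p.2 ∧ p.2 ≤ 1) := by
  rw [segWj_eq, Set.mem_union, mem_embU_image, mem_embV_image]
  rfl

lemma mem_spaceX {p : ℝ × ℝ} : p ∈ spaceX ↔ p.2 = 0 ∨ ∃ j, p ∈ segWj j := by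
  simp [spaceX, lineA]

lemma fst_sub_mem_of_mem_segWj {j : ℕ} {p : ℝ × ℝ} (hp : p ∈ segWj j) :
    0 < p.1 - 10 * j ∧ p.1 - 10 * j ≤ 1 := by
  rcases mem_segWj.1 hp with ⟨h, -⟩ | ⟨h, -⟩
  · exact h
  · constructor <;> linarith

lemma snd_mem_of_mem_segWj {j : ℕ} {p : ℝ × ℝ} (hp : p ∈ segWj j) : 0 < p.2 ∧ p.2 ≤ 1 := by
  rcases mem_segWj.1 hp with ⟨⟨h1, h2⟩, h3⟩ | ⟨-, h1, h2⟩ <;> constructor <;> linarith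

lemma measurableSet_spaceX : MeasurableSet spaceX := by
  refine MeasurableSet.union ?_ (MeasurableSet.iUnion fun j => ?_)
  · rw [lineA_eq]
    exact (measurableEmbedding_of_isometry isometry_embA).measurableSet_range
  · rw [segWj_eq]
    exact ((measurableEmbedding_of_isometry (isometry_embU j)).measurableSet_image.2
      measurableSet_Ioc).union ((measurableEmbedding_of_isometry
        (isometry_embV j)).measurableSet_image.2 measurableSet_Icc)

lemma mem_ball_iff {p z : ℝ × ℝ} {r : ℝ} :
    p ∈ Metric.ball z r ↔ (-r < p.1 - z.1 ∧ p.1 - z.1 < r) ∧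
      (-r < p.2 - z.2 ∧ p.2 - z.2 < r) := by
  rw [Metric.mem_ball, Prod.dist_eq, max_lt_iff, Real.dist_eq, Real.dist_eq, abs_lt, abs_lt]

lemma muX_restrict_ball (z : ℝ × ℝ) (r : ℝ) :
    muX.restrict (Metric.ball z r) = (μH[1]).restrict (Metric.ball z r ∩ spaceX) := by
  rw [muX, Measure.restrict_restrict measurableSet_ball]

lemma muX_ball (z : ℝ × ℝ) (r : ℝ) :
    muX (Metric.ball z r) = μH[1] (Metric.ball z r ∩ spaceX) := by
  rw [muX, Measure.restrict_apply measurableSet_ball]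

lemma setLIntegral_muX_ball_mono {z : ℝ × ℝ} {r : ℝ} {F G : ℝ × ℝ → ℝ≥0∞}
    (h : ∀ x ∈ Metric.ball z r ∩ spaceX, F x ≤ G x) :
    ∫⁻ x in Metric.ball z r, F x ∂muX ≤ ∫⁻ x in Metric.ball z r, G x ∂muX := by
  rw [muX_restrict_ball]
  exact setLIntegral_mono' (measurableSet_ball.inter measurableSet_spaceX) h

lemma le_setLIntegral_muX_ball {e : ℝ → ℝ × ℝ} (he : Isometry e) {S : Set ℝ} {z : ℝ × ℝ}
    {r : ℝ} (hS : e '' S ⊆ Metric.ball z r ∩ spaceX) (F : ℝ × ℝ → ℝ≥0∞) :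
    ∫⁻ u in S, F (e u) ≤ ∫⁻ x in Metric.ball z r, F x ∂muX := by
  rw [muX_restrict_ball, ← lintegral_hausdorff_image he]
  exact lintegral_mono_set hS

lemma volume_le_muX_ball {e : ℝ → ℝ × ℝ} (he : Isometry e) {S : Set ℝ} {z : ℝ × ℝ}
    {r : ℝ} (hS : e '' S ⊆ Metric.ball z r ∩ spaceX) :
    volume S ≤ muX (Metric.ball z r) := by
  rw [muX_ball, ← hausdorff_image he]
  exact measure_mono hS

lemma lintegral_segWj_le (j : ℕ) (F : ℝ × ℝ → ℝ≥0∞) :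
    ∫⁻ x in segWj j, F x ∂μH[1] ≤
      (∫⁻ u in Set.Ioc 0 1, F (embU j u)) + ∫⁻ v in Set.Icc (1 / 2) 1, F (embV j v) := by
  rw [segWj_eq, ← lintegral_hausdorff_image (isometry_embU j),
    ← lintegral_hausdorff_image (isometry_embV j)]
  exact lintegral_union_le _ _ _

lemma embU_image_subset (j : ℕ) : embU j '' Set.Ioc 0 1 ⊆ spaceX := fun p hp =>
  mem_spaceX.2 (Or.inr ⟨j, by rw [segWj_eq]; exact Or.inl hp⟩)

lemma embV_image_subset (j : ℕ) : embV j '' Set.Icc (1 / 2) 1 ⊆ spaceX := fun p hp =>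
  mem_spaceX.2 (Or.inr ⟨j, by rw [segWj_eq]; exact Or.inr hp⟩)

lemma embA_image_subset_ball {z : ℝ × ℝ} {r : ℝ} (hz : 0 ≤ z.2) (hr : z.2 < r) :
    embA '' Set.Ioo (z.1 - r) (z.1 + r) ⊆ Metric.ball z r ∩ spaceX := by
  rintro _ ⟨u, ⟨h1, h2⟩, rfl⟩
  refine ⟨mem_ball_iff.2 ?_, mem_spaceX.2 (Or.inl rfl)⟩
  simp only [embA]
  refine ⟨⟨?_, ?_⟩, ?_, ?_⟩ <;> linarith

lemma snd_nonneg_of_mem_spaceX {z : ℝ × ℝ} (hz : z ∈ spaceX) : 0 ≤ z.2 := by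
  rcases mem_spaceX.1 hz with h | ⟨j, h⟩
  · exact h.ge
  · exact (snd_mem_of_mem_segWj h).1.le

/-- Lower Ahlfors regularity of `X`. -/
lemma le_muX_ball {z : ℝ × ℝ} (hz : z ∈ spaceX) {r : ℝ} (hr : 0 < r) :
    ENNReal.ofReal (r / 4) ≤ muX (Metric.ball z r) := by
  rcases lt_or_ge z.2 r with h | h
  · refine le_trans ?_ (volume_le_muX_ball isometry_embA
      (embA_image_subset_ball (snd_nonneg_of_mem_spaceX hz) h))
    rw [Real.volume_Ioo]
    exact ENNReal.ofReal_le_ofReal (by linarith)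
  · rcases mem_spaceX.1 hz with h0 | ⟨j, hj⟩
    · linarith
    rcases mem_segWj.1 hj with ⟨⟨h1, h2⟩, h3⟩ | ⟨h0, h1, h2⟩
    · refine le_trans ?_ (volume_le_muX_ball (isometry_embU j)
        (S := Set.Ioo (z.1 - 10 * j - r / 4) (z.1 - 10 * j)) ?_)
      · rw [Real.volume_Ioo]
        exact ENNReal.ofReal_le_ofReal (by linarith)
      · rintro _ ⟨u, ⟨hu1, hu2⟩, rfl⟩
        refine ⟨mem_ball_iff.2 ?_, embU_image_subset j ⟨u, ⟨?_, ?_⟩, rfl⟩⟩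
        · simp only [embU]
          refine ⟨⟨?_, ?_⟩, ?_, ?_⟩ <;> linarith
        · linarith
        · linarith
    · rcases le_or_gt z.2 (3 / 4) with h4 | h4
      · refine le_trans ?_ (volume_le_muX_ball (isometry_embV j)
          (S := Set.Ioo z.2 (z.2 + r / 4)) ?_)
        · rw [Real.volume_Ioo]
          exact ENNReal.ofReal_le_ofReal (by linarith)
        · rintro _ ⟨u, ⟨hu1, hu2⟩, rfl⟩
          refine ⟨mem_ball_iff.2 ?_, embV_image_subset j ⟨u, ⟨?_, ?_⟩, rfl⟩⟩
          · simp only [embV]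
            refine ⟨⟨?_, ?_⟩, ?_, ?_⟩ <;> linarith
          · linarith
          · linarith
      · refine le_trans ?_ (volume_le_muX_ball (isometry_embV j)
          (S := Set.Ioo (z.2 - r / 4) z.2) ?_)
        · rw [Real.volume_Ioo]
          exact ENNReal.ofReal_le_ofReal (by linarith)
        · rintro _ ⟨u, ⟨hu1, hu2⟩, rfl⟩
          refine ⟨mem_ball_iff.2 ?_, embV_image_subset j ⟨u, ⟨?_, ?_⟩, rfl⟩⟩
          · simp only [embV]
            refine ⟨⟨?_, ?_⟩, ?_, ?_⟩ <;> linarith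
          · linarith
          · linarith

lemma tsum_volume_le {S : ℕ → Set ℝ} {a b : ℝ} (hm : ∀ j, MeasurableSet (S j))
    (hS : ∀ j : ℕ, S j ⊆ Set.Ioc (10 * j : ℝ) (10 * j + 2)) (hI : ∀ j, S j ⊆ Set.Ioo a b) :
    ∑' j, volume (S j) ≤ ENNReal.ofReal (b - a) := by
  rw [← measure_iUnion ?_ hm, ← Real.volume_Ioo]
  · exact measure_mono (Set.iUnion_subset hI)
  · intro i j hij
    refine Set.disjoint_left.2 fun u hi hj => hij ?_
    have h1 := hS i hi
    have h2 := hS j hj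
    have h3 : (i : ℝ) < j + 1 := by linarith [h1.1, h2.2]
    have h4 : (j : ℝ) < i + 1 := by linarith [h2.1, h1.2]
    norm_cast at h3 h4
    omega

/-- Upper Ahlfors regularity of `X`. -/
lemma muX_ball_le (z : ℝ × ℝ) {r : ℝ} (hr : 0 < r) :
    muX (Metric.ball z r) ≤ ENNReal.ofReal (8 * r) := by
  have hsub : Metric.ball z r ∩ spaceX ⊆ embA '' Set.Ioo (z.1 - r) (z.1 + r) ∪
      ((⋃ j : ℕ, embU j '' (Set.Ioc 0 1 ∩ {u | 10 * j + u ∈ Set.Ioo (z.1 - r) (z.1 + r)})) ∪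
        Metric.ball z r ∩ ⋃ j : ℕ, embV j '' Set.Icc (1 / 2) 1) := by
    rintro p ⟨hb, hp⟩
    have hb' := mem_ball_iff.1 hb
    rcases mem_spaceX.1 hp with h | ⟨j, hj⟩
    · exact Or.inl ⟨p.1, ⟨by linarith [hb'.1.1], by linarith [hb'.1.2]⟩,
        Prod.ext rfl (by simp [embA, h])⟩
    · rw [segWj_eq] at hj
      rcases hj with hj | hj
      · refine Or.inr (Or.inl (Set.mem_iUnion.2 ⟨j, ?_⟩))
        rw [mem_embU_image] at hj ⊢
        refine ⟨⟨hj.1, ?_, ?_⟩, hj.2⟩ <;> linarith [hb'.1.1, hb'.1.2]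
      · exact Or.inr (Or.inr ⟨hb, Set.mem_iUnion.2 ⟨j, hj⟩⟩)
  have hA : μH[1] (embA '' Set.Ioo (z.1 - r) (z.1 + r)) ≤ ENNReal.ofReal (2 * r) := by
    rw [hausdorff_image isometry_embA, Real.volume_Ioo]
    exact ENNReal.ofReal_le_ofReal (by linarith)
  have hU : μH[1] (⋃ j : ℕ, embU j ''
      (Set.Ioc 0 1 ∩ {u | 10 * j + u ∈ Set.Ioo (z.1 - r) (z.1 + r)})) ≤
      ENNReal.ofReal (2 * r) := by
    refine (measure_iUnion_le _).trans ?_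
    have hv : ∀ j : ℕ, μH[1] (embU j ''
        (Set.Ioc 0 1 ∩ {u | 10 * j + u ∈ Set.Ioo (z.1 - r) (z.1 + r)})) =
        volume (Set.Ioc (10 * j : ℝ) (10 * j + 1) ∩ Set.Ioo (z.1 - r) (z.1 + r)) := by
      intro j
      rw [hausdorff_image (isometry_embU j), ← measure_preimage_add volume (10 * j : ℝ)
        (Set.Ioc (10 * j : ℝ) (10 * j + 1) ∩ Set.Ioo (z.1 - r) (z.1 + r))]
      congr 1
      ext u
      simp [sub_lt_iff_lt_add', lt_sub_iff_add_lt']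
    simp_rw [hv]
    refine (tsum_volume_le (fun j => measurableSet_Ioc.inter measurableSet_Ioo) (fun j => ?_)
      (fun j => Set.inter_subset_right)).trans (ENNReal.ofReal_le_ofReal (by linarith))
    exact Set.inter_subset_left.trans (Set.Ioc_subset_Ioc_right (by linarith))
  have hV : μH[1] (Metric.ball z r ∩ ⋃ j : ℕ, embV j '' Set.Icc (1 / 2) 1) ≤
      ENNReal.ofReal (4 * r) := by
    rcases le_or_gt r 4 with h4 | h4
    · rcases Set.eq_empty_or_nonempty
        (Metric.ball z r ∩ ⋃ j : ℕ, embV j '' Set.Icc (1 / 2) 1) with he | ⟨q, hqb, hq⟩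
      · rw [he, measure_empty]
        exact zero_le
      obtain ⟨i, hi⟩ := Set.mem_iUnion.1 hq
      have hi' := (mem_embV_image.1 hi).1
      have hqb' := mem_ball_iff.1 hqb
      have : Metric.ball z r ∩ ⋃ j : ℕ, embV j '' Set.Icc (1 / 2) 1 ⊆
          embV i '' Set.Ioo (z.2 - r) (z.2 + r) := by
        rintro p ⟨hpb, hp⟩
        obtain ⟨j, hj⟩ := Set.mem_iUnion.1 hp
        have hj' := (mem_embV_image.1 hj).1
        have hpb' := mem_ball_iff.1 hpb
        have h3 : (i : ℝ) < j + 1 := by linarith [hqb'.1.2, hpb'.1.1]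
        have h4 : (j : ℝ) < i + 1 := by linarith [hqb'.1.1, hpb'.1.2]
        have hij : j = i := by
          norm_cast at h3 h4
          omega
        subst hij
        exact mem_embV_image.2 ⟨hj', by linarith [hpb'.2.1], by linarith [hpb'.2.2]⟩
      refine (measure_mono this).trans ?_
      rw [hausdorff_image (isometry_embV i), Real.volume_Ioo]
      exact ENNReal.ofReal_le_ofReal (by linarith)
    · rw [Set.inter_iUnion]
      refine (measure_iUnion_le _).trans ?_
      have hv : ∀ j : ℕ, μH[1] (Metric.ball z r ∩ embV j '' Set.Icc (1 / 2) 1) ≤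
          volume (Set.Ioc (10 * j + 1 : ℝ) (10 * j + 2) ∩
            Set.Ioo (z.1 - 2 * r) (z.1 + 2 * r)) := by
        intro j
        rcases Set.eq_empty_or_nonempty
          (Metric.ball z r ∩ embV j '' Set.Icc (1 / 2) 1) with he | ⟨q, hqb, hq⟩
        · rw [he, measure_empty]
          exact zero_le
        have hq' := (mem_embV_image.1 hq).1
        have hqb' := mem_ball_iff.1 hqb
        have hsub' : Set.Ioc (10 * j + 1 : ℝ) (10 * j + 2) ⊆
            Set.Ioo (z.1 - 2 * r) (z.1 + 2 * r) := fun u hu =>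
          ⟨by linarith [hu.1, hqb'.1.2], by linarith [hu.2, hqb'.1.1]⟩
        rw [Set.inter_eq_left.2 hsub']
        refine (measure_mono Set.inter_subset_right).trans ?_
        rw [hausdorff_image (isometry_embV j), Real.volume_Icc, Real.volume_Ioc]
        exact ENNReal.ofReal_le_ofReal (by linarith)
      refine (ENNReal.tsum_le_tsum hv).trans ?_
      refine (tsum_volume_le (fun j => measurableSet_Ioc.inter measurableSet_Ioo) (fun j => ?_)
        (fun j => Set.inter_subset_right)).trans (ENNReal.ofReal_le_ofReal (by linarith))
      exact Set.inter_subset_left.trans (Set.Ioc_subset_Ioc_left (by linarith))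
  rw [muX_ball]
  calc _ ≤ ENNReal.ofReal (2 * r) + (ENNReal.ofReal (2 * r) + ENNReal.ofReal (4 * r)) :=
        (measure_mono hsub).trans ((measure_union_le _ _).trans
          (add_le_add hA ((measure_union_le _ _).trans (add_le_add hU hV))))
    _ = _ := by
        rw [← ENNReal.ofReal_add (by positivity) (by positivity),
          ← ENNReal.ofReal_add (by positivity) (by positivity)]
        congr 1
        ring

/-- A ball not reaching the line is contained in a single `W_j`. -/
lemma ball_inter_spaceX_subset {j : ℕ} {z : ℝ × ℝ} {r : ℝ} (hz : z ∈ segWj j) (hr : r ≤ z.2) :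
    Metric.ball z r ∩ spaceX ⊆ segWj j := by
  rintro p ⟨hb, hp⟩
  have hb' := mem_ball_iff.1 hb
  rcases mem_spaceX.1 hp with h | ⟨i, hi⟩
  · linarith [hb'.2.1]
  · have h1 := fst_sub_mem_of_mem_segWj hi
    have h2 := fst_sub_mem_of_mem_segWj hz
    have h3 := snd_mem_of_mem_segWj hz
    have h4 : (i : ℝ) < j + 1 := by linarith [hb'.1.2]
    have h5 : (j : ℝ) < i + 1 := by linarith [hb'.1.1]
    have hij : i = j := by
      norm_cast at h4 h5
      omega
    exact hij ▸ hi

lemma fwt_le_one {eps : ℕ → ℝ} (heps : ∀ j, 0 < eps j ∧ eps j ≤ 1) (h : ℝ → ℝ) (p : ℝ × ℝ) :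
    fwt h eps p ≤ 1 := by
  unfold fwt
  split_ifs
  · exact le_rfl
  · exact ENNReal.ofReal_le_one.2 (min_le_left _ _)
  · exact ENNReal.ofReal_le_one.2 (heps _).2

lemma fwt_of_mem_segWj {eps : ℕ → ℝ} (heps : ∀ j, 0 < eps j ∧ eps j ≤ 1) {j : ℕ} {p : ℝ × ℝ}
    (hp : p ∈ segWj j) :
    fwt h18 eps p = ENNReal.ofReal (min 1 (eps j * gfun h18 (p.1 - 10 * j))) := by
  have h1 := fst_sub_mem_of_mem_segWj hp
  have h2 := snd_mem_of_mem_segWj hp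
  have hfl : ⌊p.1 / 10⌋ = (j : ℤ) := by
    rw [Int.floor_eq_iff]
    push_cast
    constructor <;> linarith
  rw [fwt, if_neg h2.1.ne', hfl]
  simp only [Int.cast_natCast, Int.toNat_natCast]
  split_ifs with h
  · rfl
  · rcases mem_segWj.1 hp with ⟨-, h3⟩ | ⟨h3, -⟩
    · exact absurd h3 h
    · have h4 : p.1 - 10 * (j : ℝ) = 1 := by linarith
      rw [h4, gfun_h18_one, mul_one, min_eq_right (heps j).2]

lemma fwt_of_mem_lineA {h : ℝ → ℝ} {eps : ℕ → ℝ} {p : ℝ × ℝ} (hp : p.2 = 0) :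
    fwt h eps p = 1 := if_pos hp

lemma fwt_embV {eps : ℕ → ℝ} (heps : ∀ j, 0 < eps j ∧ eps j ≤ 1) {j : ℕ} {v : ℝ}
    (hv : v ∈ Set.Icc (1 / 2 : ℝ) 1) : fwt h18 eps (embV j v) = ENNReal.ofReal (eps j) := by
  rw [fwt_of_mem_segWj heps (j := j) (by rw [segWj_eq]; exact Or.inr ⟨v, hv, rfl⟩)]
  simp [embV, gfun_h18_one, (heps j).2]

lemma fwt_embU {eps : ℕ → ℝ} (heps : ∀ j, 0 < eps j ∧ eps j ≤ 1) {j : ℕ} {u : ℝ}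
    (hu : u ∈ Set.Ioc (0 : ℝ) 1) :
    fwt h18 eps (embU j u) = ENNReal.ofReal (min 1 (eps j * gfun h18 u)) := by
  rw [fwt_of_mem_segWj heps (j := j) (by rw [segWj_eq]; exact Or.inl ⟨u, hu, rfl⟩)]
  simp [embU]

/-- `f ≤ ε_j (1 + 1_{U_j} h)` on `W_j`. -/
lemma fwt_le_of_mem_segWj {eps : ℕ → ℝ} (heps : ∀ j, 0 < eps j ∧ eps j ≤ 1) {j : ℕ}
    {p : ℝ × ℝ} (hp : p ∈ segWj j) :
    fwt h18 eps p ≤ ENNReal.ofReal (eps j) * (1 + (embU j '' Set.Ioc 0 1).indicator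
      (fun y => ENNReal.ofReal (h18 (y.1 - 10 * j))) p) := by
  have he := (heps j).1
  rw [segWj_eq] at hp
  by_cases hU : p ∈ embU j '' Set.Ioc 0 1
  · rw [Set.indicator_of_mem hU]
    obtain ⟨u, hu, rfl⟩ := hU
    have hh := h18_pos hu.1 hu.2
    have h2 : (embU j u).1 - 10 * j = u := by simp [embU]
    rw [fwt_embU heps hu, h2, ← ENNReal.ofReal_one,
      ← ENNReal.ofReal_add zero_le_one hh.le, ← ENNReal.ofReal_mul he.le]
    refine ENNReal.ofReal_le_ofReal ((min_le_right _ _).trans ?_)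
    have := gfun_le_one_add hu.1 hu.2
    gcongr
  · obtain ⟨v, hv, rfl⟩ := hp.resolve_left hU
    rw [Set.indicator_of_notMem hU, fwt_embV heps hv]
    simp

/-- The weight is essentially constant on points of `W_j` with comparable parameters. -/
lemma fwt_le_of_comparable {eps : ℕ → ℝ} (heps : ∀ j, 0 < eps j ∧ eps j ≤ 1) {j : ℕ}
    {p q : ℝ × ℝ} (hp : p ∈ segWj j) (hq : q ∈ segWj j)
    (hpq : p.1 - 10 * j ≤ 4 * (q.1 - 10 * j)) (hqp : q.1 - 10 * j ≤ 4 * (p.1 - 10 * j)) :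
    fwt h18 eps p ≤ 108 * fwt h18 eps q := by
  have h1 := fst_sub_mem_of_mem_segWj hp
  have h2 := fst_sub_mem_of_mem_segWj hq
  have he := (heps j).1
  have h := gfun_le_of_comparable h2.1 h1.1 h1.2 hqp hpq h2.2
  rw [fwt_of_mem_segWj heps hp, fwt_of_mem_segWj heps hq]
  have : (108 : ℝ≥0∞) = ENNReal.ofReal 108 := by norm_num
  rw [this, ← ENNReal.ofReal_mul (by norm_num)]
  refine ENNReal.ofReal_le_ofReal ?_
  rw [mul_min_of_nonneg _ _ (by norm_num)]
  refine min_le_min (by norm_num) ?_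
  calc eps j * gfun h18 (p.1 - 10 * j) ≤ eps j * (108 * gfun h18 (q.1 - 10 * j)) := by gcongr
    _ = _ := by ring

lemma mOpX_le {F : ℝ × ℝ → ℝ≥0∞} {K : ℝ≥0∞} (h : ∀ y ∈ spaceX, F y ≤ K) (x : ℝ × ℝ) :
    mOpX F x ≤ K := by
  refine iSup_le fun z => iSup_le fun _ => iSup_le fun r => iSup_le fun _ => iSup_le fun _ => ?_
  calc _ ≤ (muX (Metric.ball z r))⁻¹ * (K * muX (Metric.ball z r)) := by
        gcongr
        refine (setLIntegral_muX_ball_mono fun y hy => h y hy.2).trans_eq ?_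
        rw [setLIntegral_const]
    _ = K * ((muX (Metric.ball z r))⁻¹ * muX (Metric.ball z r)) := by ring
    _ ≤ K * 1 := by gcongr; exact ENNReal.inv_mul_le_one _
    _ = K := mul_one K

/-- Pointwise bound for the maximal function of a function dominated by `e (1 + 1_{U_j} h)`. -/
lemma mOpX_le_majorant {F : ℝ × ℝ → ℝ≥0∞} {e : ℝ≥0∞} (he : e ≠ ⊤) {j : ℕ}
    (h : ∀ y ∈ spaceX, F y ≤ e * (1 + (embU j '' Set.Ioc 0 1).indicator
      (fun y => ENNReal.ofReal (h18 (y.1 - 10 * j))) y)) {x : ℝ × ℝ} (hx : x ∈ segWj j) :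
    mOpX F x ≤ e * ENNReal.ofReal (1732 * majorant (x.1 - 10 * j)) := by
  obtain ⟨ht, ht1⟩ := fst_sub_mem_of_mem_segWj hx
  set t := x.1 - 10 * j with htdef
  have hmaj := majorant_pos ht ht1
  have hmaj1 := one_le_majorant ht ht1
  have hUm : MeasurableSet (embU j '' Set.Ioc 0 1) :=
    (measurableEmbedding_of_isometry (isometry_embU j)).measurableSet_image.2 measurableSet_Ioc
  refine iSup_le fun z => iSup_le fun hz => iSup_le fun r => iSup_le fun hr =>
    iSup_le fun hxz => ?_
  have hI : ∫⁻ y in Metric.ball z r, (embU j '' Set.Ioc 0 1).indicator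
      (fun y => ENNReal.ofReal (h18 (y.1 - 10 * j))) y ∂muX ≤
      ENNReal.ofReal (432 * r * majorant t) := by
    rw [setLIntegral_indicator hUm]
    calc _ ≤ ∫⁻ y in embU j '' (Set.Ioc 0 1 ∩ Set.Ioo (t - 2 * r) (t + 2 * r)),
          ENNReal.ofReal (h18 (y.1 - 10 * j)) ∂μH[1] := by
          refine lintegral_mono' (Measure.restrict_mono ?_ Measure.restrict_le_self) le_rfl
          rintro y ⟨hy, hyz⟩
          rw [mem_embU_image] at hy ⊢
          have h1 := mem_ball_iff.1 hyz
          have h2 := mem_ball_iff.1 hxz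
          exact ⟨⟨hy.1, by linarith [h1.1.1, h2.1.2], by linarith [h1.1.2, h2.1.1]⟩, hy.2⟩
      _ = ∫⁻ u in Set.Ioc 0 1 ∩ Set.Ioo (t - 2 * r) (t + 2 * r), ENNReal.ofReal (h18 u) := by
          rw [lintegral_hausdorff_image (isometry_embU j)]
          simp [embU]
      _ ≤ _ := lintegral_h18_Ioo_le ht ht1 hr
  have hinv : (muX (Metric.ball z r))⁻¹ ≤ ENNReal.ofReal (4 / r) := by
    rw [← inv_div, ENNReal.ofReal_inv_of_pos (by positivity)]
    exact ENNReal.inv_le_inv.2 (le_muX_ball hz hr)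
  calc _ ≤ (muX (Metric.ball z r))⁻¹ *
        (e * (muX (Metric.ball z r) + ENNReal.ofReal (432 * r * majorant t))) := by
        gcongr
        refine (setLIntegral_muX_ball_mono fun y hy => h y hy.2).trans ?_
        rw [lintegral_const_mul' _ _ he, lintegral_add_left measurable_const]
        gcongr
        simp
    _ = e * ((muX (Metric.ball z r))⁻¹ * muX (Metric.ball z r) +
        (muX (Metric.ball z r))⁻¹ * ENNReal.ofReal (432 * r * majorant t)) := by ring
    _ ≤ e * (1 + ENNReal.ofReal (4 / r) * ENNReal.ofReal (432 * r * majorant t)) := by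
        gcongr
        exact ENNReal.inv_mul_le_one _
    _ ≤ _ := by
        gcongr
        rw [← ENNReal.ofReal_mul (by positivity), ← ENNReal.ofReal_one,
          ← ENNReal.ofReal_add zero_le_one (by positivity)]
        refine ENNReal.ofReal_le_ofReal ?_
        have : 4 / r * (432 * r * majorant t) = 1728 * majorant t := by
          field_simp
          ring
        rw [this]
        linarith

/-- Balls reaching the line. -/
lemma ainfty_of_snd_lt {eps : ℕ → ℝ} (heps : ∀ j, 0 < eps j ∧ eps j ≤ 1) {z : ℝ × ℝ}
    (hz : z ∈ spaceX) {r : ℝ} (hr : 0 < r) (hzr : z.2 < r) :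
    ∫⁻ x in Metric.ball z r, mOpX ((Metric.ball z r).indicator (fwt h18 eps)) x ∂muX
      ≤ 4 * ∫⁻ x in Metric.ball z r, fwt h18 eps x ∂muX := by
  have hM : ∀ x, mOpX ((Metric.ball z r).indicator (fwt h18 eps)) x ≤ 1 :=
    mOpX_le fun y _ => (Set.indicator_le_self' (fun _ _ => zero_le) y).trans (fwt_le_one heps _ y)
  have hlow := le_setLIntegral_muX_ball isometry_embA
    (embA_image_subset_ball (snd_nonneg_of_mem_spaceX hz) hzr) (fwt h18 eps)
  simp only [fwt_of_mem_lineA (show (embA _).2 = 0 from rfl), lintegral_one,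
    Measure.restrict_apply_univ, Real.volume_Ioo] at hlow
  calc _ ≤ ∫⁻ _ in Metric.ball z r, 1 ∂muX := lintegral_mono hM
    _ = muX (Metric.ball z r) := by simp
    _ ≤ ENNReal.ofReal (8 * r) := muX_ball_le z hr
    _ = 4 * ENNReal.ofReal (z.1 + r - (z.1 - r)) := by
        have : (4 : ℝ≥0∞) = ENNReal.ofReal 4 := by norm_num
        rw [this, ← ENNReal.ofReal_mul (by norm_num)]
        congr 1
        ring
    _ ≤ _ := by gcongr

/-- Balls on which the weight is essentially constant. -/
lemma ainfty_of_comparable {f : ℝ × ℝ → ℝ≥0∞} {K : ℝ≥0∞} (hK : K ≠ ⊤) {z : ℝ × ℝ} {r : ℝ}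
    (h : ∀ p ∈ Metric.ball z r ∩ spaceX, ∀ q ∈ Metric.ball z r ∩ spaceX, f p ≤ K * f q) :
    ∫⁻ x in Metric.ball z r, mOpX ((Metric.ball z r).indicator f) x ∂muX
      ≤ K * ∫⁻ x in Metric.ball z r, f x ∂muX := by
  rw [← lintegral_const_mul' _ _ hK]
  refine setLIntegral_muX_ball_mono fun x hx => mOpX_le (fun y hy => ?_) x
  by_cases hyb : y ∈ Metric.ball z r
  · rw [Set.indicator_of_mem hyb]
    exact h y ⟨hyb, hy⟩ x hx
  · simp [Set.indicator_of_notMem hyb]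

/-- Large balls centered on `V_j` which do not reach the line. -/
lemma ainfty_of_embV {eps : ℕ → ℝ} (heps : ∀ j, 0 < eps j ∧ eps j ≤ 1) {j : ℕ} {z : ℝ × ℝ}
    {r : ℝ} (hz : z ∈ segWj j) (hz1 : z.1 = 10 * j + 1) (hr : 3 / 4 < r) (hrz : r ≤ z.2) :
    ∫⁻ x in Metric.ball z r, mOpX ((Metric.ball z r).indicator (fwt h18 eps)) x ∂muX
      ≤ 7000 * ∫⁻ x in Metric.ball z r, fwt h18 eps x ∂muX := by
  have hsub := ball_inter_spaceX_subset hz hrz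
  have hz2 := snd_mem_of_mem_segWj hz
  have hM : ∀ x ∈ segWj j, mOpX ((Metric.ball z r).indicator (fwt h18 eps)) x ≤
      ENNReal.ofReal (eps j) * ENNReal.ofReal (1732 * majorant (x.1 - 10 * j)) := fun x hx =>
    mOpX_le_majorant ENNReal.ofReal_ne_top (fun y hy => by
      by_cases hyb : y ∈ Metric.ball z r
      · rw [Set.indicator_of_mem hyb]
        exact fwt_le_of_mem_segWj heps (hsub ⟨hyb, hy⟩)
      · simp [Set.indicator_of_notMem hyb]) hx
  have hmul : ∀ t, ENNReal.ofReal (1732 * majorant t) = 1732 * ENNReal.ofReal (majorant t) := by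
    intro t
    rw [ENNReal.ofReal_mul (by norm_num)]
    norm_num
  have hup : ∫⁻ x in Metric.ball z r, mOpX ((Metric.ball z r).indicator (fwt h18 eps)) x ∂muX
      ≤ ENNReal.ofReal (eps j) * (1732 * 2) := by
    calc _ ≤ ∫⁻ x in Metric.ball z r,
          ENNReal.ofReal (eps j) * (1732 * ENNReal.ofReal (majorant (x.1 - 10 * j))) ∂muX := by
          refine setLIntegral_muX_ball_mono fun x hx => ?_
          rw [← hmul]
          exact hM x (hsub hx)
      _ = ENNReal.ofReal (eps j) * (1732 * ∫⁻ x in Metric.ball z r,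
          ENNReal.ofReal (majorant (x.1 - 10 * j)) ∂muX) := by
          rw [lintegral_const_mul' _ _ ENNReal.ofReal_ne_top,
            lintegral_const_mul' _ _ (by norm_num)]
      _ ≤ _ := by
          gcongr
          rw [muX_restrict_ball]
          refine (lintegral_mono_set hsub).trans ((lintegral_segWj_le j _).trans ?_)
          have h1 : ∀ u, (embU j u).1 - 10 * j = u := fun u => by simp [embU]
          have h2 : ∀ v, (embV j v).1 - 10 * j = 1 := fun v => by simp [embV]
          simp only [h1, h2, lintegral_majorant, majorant_one, ENNReal.ofReal_one, lintegral_one,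
            Measure.restrict_apply_univ, Real.volume_Icc]
          exact (add_le_add (by simp) (ENNReal.ofReal_le_one.2 (by norm_num))).trans_eq
            one_add_one_eq_two
  have hlow : ENNReal.ofReal (eps j) * ENNReal.ofReal (1 / 2) ≤
      ∫⁻ x in Metric.ball z r, fwt h18 eps x ∂muX := by
    refine le_trans (le_of_eq ?_) (le_setLIntegral_muX_ball (isometry_embV j)
      (S := Set.Icc (1 / 2) 1) ?_ (fwt h18 eps))
    · rw [setLIntegral_congr_fun measurableSet_Icc (fun v hv => fwt_embV heps hv),
        setLIntegral_const, Real.volume_Icc]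
      norm_num
    · refine Set.subset_inter ?_ (embV_image_subset j)
      rintro _ ⟨v, ⟨hv1, hv2⟩, rfl⟩
      rw [mem_ball_iff]
      simp only [embV, hz1]
      refine ⟨⟨?_, ?_⟩, ?_, ?_⟩ <;> linarith
  refine hup.trans (le_trans ?_ (mul_le_mul_right hlow 7000))
  have h1 : (7000 : ℝ≥0∞) = ENNReal.ofReal 7000 := by norm_num
  have h2 : (1732 * 2 : ℝ≥0∞) = ENNReal.ofReal 3464 := by norm_num
  have he := (heps j).1
  rw [h1, h2, ← ENNReal.ofReal_mul he.le, ← ENNReal.ofReal_mul he.le,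
    ← ENNReal.ofReal_mul (by norm_num)]
  exact ENNReal.ofReal_le_ofReal (by linarith)

lemma fwt_mem_Ainfty {eps : ℕ → ℝ} (heps : ∀ j, 0 < eps j ∧ eps j ≤ 1) {z : ℝ × ℝ}
    (hz : z ∈ spaceX) {r : ℝ} (hr : 0 < r) :
    ∫⁻ x in Metric.ball z r, mOpX ((Metric.ball z r).indicator (fwt h18 eps)) x ∂muX
      ≤ 7000 * ∫⁻ x in Metric.ball z r, fwt h18 eps x ∂muX := by
  rcases lt_or_ge z.2 r with h | h
  · refine (ainfty_of_snd_lt heps hz hr h).trans ?_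
    gcongr
    norm_num
  rcases mem_spaceX.1 hz with h0 | ⟨j, hj⟩
  · linarith
  have hsub := ball_inter_spaceX_subset hj h
  have hcomp : (∀ p ∈ Metric.ball z r ∩ spaceX, ∀ q ∈ Metric.ball z r ∩ spaceX,
      p.1 - 10 * j ≤ 4 * (q.1 - 10 * j)) →
      ∫⁻ x in Metric.ball z r, mOpX ((Metric.ball z r).indicator (fwt h18 eps)) x ∂muX
        ≤ 7000 * ∫⁻ x in Metric.ball z r, fwt h18 eps x ∂muX := by
    intro hc
    refine (ainfty_of_comparable (K := 108) (by norm_num) fun p hp q hq =>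
      fwt_le_of_comparable heps (hsub hp) (hsub hq) (hc p hp q hq) (hc q hq p hp)).trans ?_
    gcongr
    norm_num
  rcases mem_segWj.1 hj with ⟨⟨h1, h2⟩, h3⟩ | ⟨h0, h1, h2⟩
  · refine hcomp fun p hp q hq => ?_
    have hp' := mem_ball_iff.1 hp.1
    have hq' := mem_ball_iff.1 hq.1
    linarith [hp'.1.2, hq'.1.1]
  · rcases le_or_gt r (3 / 4) with h4 | h4
    · refine hcomp fun p hp q hq => ?_
      have hq' := mem_ball_iff.1 hq.1
      have hp1 := fst_sub_mem_of_mem_segWj (hsub hp)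
      linarith [hq'.1.1]
    · exact ainfty_of_embV heps hj h0 h4 h

lemma exists_le_h18_rpow {p : ℝ} (hp : 1 < p) :
    ∃ c : ℝ, 0 < c ∧ ∀ t, 0 < t → t ≤ 1 → c * t⁻¹ ≤ h18 t ^ p := by
  have hp0 : 0 < p := by linarith
  set η := (p - 1) / (3 * p) with hη
  have hη0 : 0 < η := div_pos (by linarith) (by positivity)
  set K := 1 + 1 / η with hK
  have hK0 : 0 < K := by positivity
  refine ⟨((K ^ 3)⁻¹) ^ p, by positivity, fun t ht ht1 => ?_⟩
  have hx0 : 0 < t⁻¹ := inv_pos.2 ht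
  have hx1 : 1 ≤ t⁻¹ := (one_le_inv₀ ht).2 ht1
  have hL1 := one_le_logE ht ht1
  have hL : logE t ≤ K * t⁻¹ ^ η := by
    have h1 := Real.log_le_rpow_div hx0.le hη0
    have h2 := Real.one_le_rpow hx1 hη0.le
    rw [Real.log_inv] at h1
    have h3 := logE_eq ht
    have h4 : K * t⁻¹ ^ η = t⁻¹ ^ η + t⁻¹ ^ η / η := by rw [hK]; ring
    linarith
  have hpow : (t⁻¹ ^ η) ^ 3 = t⁻¹ ^ (3 * η) := by
    rw [← Real.rpow_natCast, ← Real.rpow_mul hx0.le]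
    congr 1
    push_cast
    ring
  have hh : (K ^ 3)⁻¹ * t⁻¹ ^ (1 - 3 * η) ≤ h18 t := by
    have h1 : logE t ^ 3 ≤ K ^ 3 * t⁻¹ ^ (3 * η) := by
      rw [← hpow, ← mul_pow]
      gcongr
    rw [Real.rpow_sub hx0, Real.rpow_one, h18_eq, mul_inv]
    calc (K ^ 3)⁻¹ * (t⁻¹ / t⁻¹ ^ (3 * η)) = t⁻¹ * (K ^ 3 * t⁻¹ ^ (3 * η))⁻¹ := by
          rw [mul_inv]; ring
      _ ≤ t⁻¹ * (logE t ^ 3)⁻¹ := by gcongr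
  have hexp : (1 - 3 * η) * p = 1 := by
    rw [hη]
    field_simp
    ring
  calc ((K ^ 3)⁻¹) ^ p * t⁻¹ = ((K ^ 3)⁻¹ * t⁻¹ ^ (1 - 3 * η)) ^ p := by
        rw [Real.mul_rpow (by positivity) (by positivity), ← Real.rpow_mul hx0.le, hexp,
          Real.rpow_one]
    _ ≤ h18 t ^ p := Real.rpow_le_rpow (by positivity) hh hp0.le

lemma lintegral_mul_inv {c δ : ℝ} (hc : 0 ≤ c) (hδ : 0 < δ) (hδ1 : δ ≤ 1) :
    ∫⁻ u in Set.Ioc δ 1, ENNReal.ofReal (c * u⁻¹) = ENNReal.ofReal (c * -Real.log δ) := by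
  have hcont : ContinuousOn (fun u : ℝ => c * u⁻¹) (Set.Icc δ 1) :=
    continuousOn_const.mul (continuousOn_inv₀.mono fun u hu => (hδ.trans_le hu.1).ne')
  rw [← ofReal_integral_eq_lintegral_ofReal
      (hcont.integrableOn_Icc.mono_set Set.Ioc_subset_Icc_self)
      ((ae_restrict_iff' measurableSet_Ioc).2 (Filter.Eventually.of_forall fun u hu =>
        mul_nonneg hc (inv_nonneg.2 (hδ.trans hu.1).le))),
    ← intervalIntegral.integral_of_le hδ1, intervalIntegral.integral_const_mul,
    integral_inv_of_pos hδ one_pos, one_div, Real.log_inv]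

lemma embU_image_subset_ball (j : ℕ) {δ : ℝ} (hδ : 0 ≤ δ) :
    embU j '' Set.Ioc δ 1 ⊆ Metric.ball ((10 * j + 1 : ℝ), (1 : ℝ)) 1 ∩ spaceX := by
  refine Set.subset_inter ?_ ((Set.image_mono (Set.Ioc_subset_Ioc_left hδ)).trans
    (embU_image_subset j))
  rintro _ ⟨u, ⟨hu0, hu1⟩, rfl⟩
  rw [mem_ball_iff]
  simp only [embU]
  refine ⟨⟨?_, ?_⟩, ?_, ?_⟩ <;> linarith

lemma tip_mem_segWj (j : ℕ) : ((10 * j + 1 : ℝ), (1 : ℝ)) ∈ segWj j :=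
  mem_segWj.2 (Or.inr ⟨rfl, by norm_num, le_rfl⟩)

lemma setLIntegral_fwt_tip_le {eps : ℕ → ℝ} (heps : ∀ j, 0 < eps j ∧ eps j ≤ 1) (j : ℕ) :
    ∫⁻ x in Metric.ball ((10 * j + 1 : ℝ), (1 : ℝ)) 1, fwt h18 eps x ∂muX ≤
      ENNReal.ofReal (eps j) * 2 := by
  have he := (heps j).1
  rw [muX_restrict_ball]
  refine (lintegral_mono_set (ball_inter_spaceX_subset (tip_mem_segWj j) le_rfl)).trans
    ((lintegral_segWj_le j _).trans ?_)
  have hU : ∫⁻ u in Set.Ioc 0 1, fwt h18 eps (embU j u) ≤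
      ENNReal.ofReal (eps j) * (1 + ENNReal.ofReal (1 / 2)) := by
    calc _ ≤ ∫⁻ u in Set.Ioc 0 1, ENNReal.ofReal (eps j) * (1 + ENNReal.ofReal (h18 u)) := by
          refine setLIntegral_mono' measurableSet_Ioc fun u hu => ?_
          have hh := h18_pos hu.1 hu.2
          rw [fwt_embU heps hu, ← ENNReal.ofReal_one, ← ENNReal.ofReal_add zero_le_one hh.le,
            ← ENNReal.ofReal_mul he.le]
          refine ENNReal.ofReal_le_ofReal ((min_le_right _ _).trans ?_)
          have := gfun_le_one_add hu.1 hu.2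
          gcongr
      _ = _ := by
          rw [lintegral_const_mul' _ _ ENNReal.ofReal_ne_top, lintegral_add_left measurable_const,
            lintegral_h18 one_pos le_rfl, logE_one]
          simp
  have hV : ∫⁻ v in Set.Icc (1 / 2) 1, fwt h18 eps (embV j v) =
      ENNReal.ofReal (eps j) * ENNReal.ofReal (1 / 2) := by
    rw [setLIntegral_congr_fun measurableSet_Icc (fun v hv => fwt_embV heps hv),
      setLIntegral_const, Real.volume_Icc]
    norm_num
  rw [hV]
  refine (add_le_add_left hU _).trans_eq ?_
  rw [← mul_add, add_assoc, ← ENNReal.ofReal_add (by norm_num) (by norm_num), add_halves,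
    ENNReal.ofReal_one, one_add_one_eq_two]

lemma le_setLIntegral_fwt_rpow_tip {eps : ℕ → ℝ} (heps : ∀ j, 0 < eps j ∧ eps j ≤ 1) {j : ℕ}
    {p c δ : ℝ} (hp : 0 < p) (hc : 0 ≤ c) (hδ : 0 < δ) (hδ1 : δ ≤ 1) (hj : eps j ≤ δ)
    (h : ∀ t, 0 < t → t ≤ 1 → c * t⁻¹ ≤ h18 t ^ p) :
    ENNReal.ofReal (eps j) ^ p * ENNReal.ofReal (c * -Real.log δ) ≤
      ∫⁻ x in Metric.ball ((10 * j + 1 : ℝ), (1 : ℝ)) 1, fwt h18 eps x ^ p ∂muX := by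
  have he := (heps j).1
  refine le_trans ?_ (le_setLIntegral_muX_ball (isometry_embU j)
    (embU_image_subset_ball j hδ.le) _)
  rw [← lintegral_mul_inv hc hδ hδ1, ← lintegral_const_mul' _ _ (by finiteness)]
  refine setLIntegral_mono' measurableSet_Ioc fun u hu => ?_
  have hu0 := hδ.trans hu.1
  have hh := h18_pos hu0 hu.2
  have hL := one_le_logE hu0 hu.2
  calc _ ≤ ENNReal.ofReal (eps j) ^ p * ENNReal.ofReal (h18 u ^ p) := by
        gcongr
        exact h u hu0 hu.2
    _ = ENNReal.ofReal (eps j * h18 u) ^ p := by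
        rw [← ENNReal.ofReal_rpow_of_pos hh, ENNReal.ofReal_mul he.le,
          ENNReal.mul_rpow_of_nonneg _ _ hp.le]
    _ ≤ _ := by
        rw [fwt_embU heps ⟨hu0, hu.2⟩]
        gcongr
        refine le_min ?_ (mul_le_mul_of_nonneg_left (le_max_left _ _) he.le)
        rw [h18_eq, ← div_eq_mul_inv, div_le_one (by positivity)]
        calc eps j ≤ u * 1 := by linarith [hu.1]
          _ ≤ u * logE u ^ 3 := by gcongr; exact one_le_pow₀ hL

lemma fwt_not_RH {eps : ℕ → ℝ} (heps : ∀ j, 0 < eps j ∧ eps j ≤ 1)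
    (hlim : Filter.Tendsto eps Filter.atTop (nhds 0)) {p : ℝ} (hp : 1 < p) :
    ¬ ∃ C : ℝ≥0∞, C ≠ ⊤ ∧ ∀ z ∈ spaceX, ∀ r : ℝ, 0 < r →
        ((muX (Metric.ball z r))⁻¹
            * ∫⁻ x in Metric.ball z r, fwt h18 eps x ^ p ∂muX) ^ (1 / p)
          ≤ C * ((muX (Metric.ball z r))⁻¹
              * ∫⁻ x in Metric.ball z r, fwt h18 eps x ∂muX) := by
  rintro ⟨C, hC, H⟩
  have hp0 : 0 < p := by linarith
  obtain ⟨c, hc, hcb⟩ := exists_le_h18_rpow hp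
  set M : ℝ≥0∞ := 8 * (C * 8) ^ p with hM
  have hMtop : M ≠ ⊤ := by finiteness
  set δ : ℝ := Real.exp (-((M.toReal + 1) / c)) with hδdef
  have hδ : 0 < δ := Real.exp_pos _
  have hδ1 : δ ≤ 1 := Real.exp_le_one_iff.2 (by
    have : 0 ≤ M.toReal := ENNReal.toReal_nonneg
    have : 0 ≤ (M.toReal + 1) / c := by positivity
    linarith)
  obtain ⟨j, hj⟩ := (hlim.eventually_lt_const hδ).exists
  have he := (heps j).1
  have hzX : ((10 * j + 1 : ℝ), (1 : ℝ)) ∈ spaceX := mem_spaceX.2 (Or.inr ⟨j, tip_mem_segWj j⟩)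
  have h := H _ hzX 1 one_pos
  rw [one_div, ENNReal.rpow_inv_le_iff hp0] at h
  have h8 : (8 : ℝ≥0∞)⁻¹ ≤ (muX (Metric.ball ((10 * j + 1 : ℝ), (1 : ℝ)) 1))⁻¹ :=
    ENNReal.inv_le_inv.2 ((muX_ball_le _ one_pos).trans_eq (by norm_num))
  have h4 : (muX (Metric.ball ((10 * j + 1 : ℝ), (1 : ℝ)) 1))⁻¹ ≤ 4 := by
    rw [← inv_inv (4 : ℝ≥0∞)]
    refine ENNReal.inv_le_inv.2 (le_trans (le_of_eq ?_) (le_muX_ball hzX one_pos))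
    rw [ENNReal.ofReal_div_of_pos (by norm_num)]
    simp
  have hlow := le_setLIntegral_fwt_rpow_tip heps hp0 hc.le hδ hδ1 hj.le hcb
  have hup := setLIntegral_fwt_tip_le heps j
  have hlog : c * -Real.log δ = M.toReal + 1 := by
    rw [hδdef, Real.log_exp]
    field_simp
  rw [hlog] at hlow
  have hchain : ENNReal.ofReal (eps j) ^ p * (8⁻¹ * ENNReal.ofReal (M.toReal + 1)) ≤
      ENNReal.ofReal (eps j) ^ p * (C * 8) ^ p := by
    calc _ = 8⁻¹ * (ENNReal.ofReal (eps j) ^ p * ENNReal.ofReal (M.toReal + 1)) := by ring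
      _ ≤ _ := mul_le_mul' h8 hlow
      _ ≤ _ := h
      _ ≤ (C * (4 * (ENNReal.ofReal (eps j) * 2))) ^ p := by gcongr
      _ = (ENNReal.ofReal (eps j) * (C * 8)) ^ p := by congr 1; ring
      _ = _ := ENNReal.mul_rpow_of_nonneg _ _ hp0.le
  have hpos : 0 < ENNReal.ofReal (eps j) := ENNReal.ofReal_pos.2 he
  rw [ENNReal.mul_le_mul_iff_right (ENNReal.rpow_pos hpos ENNReal.ofReal_ne_top).ne'
    (by finiteness)] at hchain
  have hfin : ENNReal.ofReal (M.toReal + 1) ≤ M := by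
    calc ENNReal.ofReal (M.toReal + 1) = 8 * (8⁻¹ * ENNReal.ofReal (M.toReal + 1)) := by
          rw [← mul_assoc, ENNReal.mul_inv_cancel (by norm_num) (by norm_num), one_mul]
      _ ≤ 8 * (C * 8) ^ p := by gcongr
  rw [ENNReal.ofReal_le_iff_le_toReal hMtop] at hfin
  linarith

/-- Failure of the strong Reverse Hölder Inequality for `A_∞` weights: the weight
`f = f_{h18}` satisfies the (strong) Fujii-Wilson `A_∞` condition on `X`, but belongs to
no strong Reverse Hölder class `RH_p`, `p > 1`. -/
theorem fwt_mem_Ainfty_not_RH (eps : ℕ → ℝ)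
    (heps : ∀ j, 0 < eps j ∧ eps j ≤ 1)
    (hlim : Filter.Tendsto eps Filter.atTop (nhds 0)) :
    (∃ C : ℝ≥0∞, C ≠ ⊤ ∧ ∀ z ∈ spaceX, ∀ r : ℝ, 0 < r →
      ∫⁻ x in Metric.ball z r, mOpX ((Metric.ball z r).indicator (fwt h18 eps)) x ∂muX
        ≤ C * ∫⁻ x in Metric.ball z r, fwt h18 eps x ∂muX) ∧
    (∀ p : ℝ, 1 < p →
      ¬ ∃ C : ℝ≥0∞, C ≠ ⊤ ∧ ∀ z ∈ spaceX, ∀ r : ℝ, 0 < r →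
        ((muX (Metric.ball z r))⁻¹
            * ∫⁻ x in Metric.ball z r, fwt h18 eps x ^ p ∂muX) ^ (1 / p)
          ≤ C * ((muX (Metric.ball z r))⁻¹
              * ∫⁻ x in Metric.ball z r, fwt h18 eps x ∂muX)) :=
  ⟨⟨7000, by norm_num, fun _ hz _ hr => fwt_mem_Ainfty heps hz hr⟩,
    fun _ hp => fwt_not_RH heps hlim hp⟩

end Counterexample
end
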